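/- Let n ≥ 1 and let u, v be probability densities on ℝⁿ such that (T_s u dx, T_t v dx) ∈ Π_𝒮 for all s, t ≥ 0. Then for every τ > 0, 𝒜(T_τ u dx, T_τ v dx) ≤ 𝒜(u dx, v dx) − n ∫₀^τ sinh²( (H(T_t u dx|dx) − H(T_t v dx|dx)) / (2n) ) dt. -/

import Mathlib

open MeasureTheory Filter Set
open scoped ENNReal NNReal

noncomputable section

abbrev Eucl (n : ℕ) : Type := EuclideanSpace ℝ (Fin n)

/-- Heat semigroup `T_t` on `ℝⁿ` (generator `Δ/2`), with `T_0 f = f`. -/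
noncomputable def heat (n : ℕ) (t : ℝ) (f : Eucl n → ℝ) (x : Eucl n) : ℝ :=
  if t = 0 then f x
  else ∫ y : Eucl n, f y * Real.exp (-‖x - y‖ ^ 2 / (2 * t)) / (2 * Real.pi * t) ^ ((n : ℝ) / 2)

/-- Relative entropy `H(ρ dx | dx) = ∫ ρ log ρ dx` of a density `ρ`. -/
noncomputable def entDens (n : ℕ) (ρ : Eucl n → ℝ) : ℝ :=
  ∫ x : Eucl n, ρ x * Real.log (ρ x)

/-- The measure `ρ dx`. -/
noncomputable def densMeas (n : ℕ) (ρ : Eucl n → ℝ) : Measure (Eucl n) :=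
  (volume : Measure (Eucl n)).withDensity fun x => ENNReal.ofReal (ρ x)

/-- The measure `R₀₁(dx dy) = e^{-|x-y|²/2} (2π)^{-n/2} dx dy` on `ℝⁿ × ℝⁿ`. -/
noncomputable def R01 (n : ℕ) : Measure (Eucl n × Eucl n) :=
  (volume : Measure (Eucl n × Eucl n)).withDensity fun p =>
    ENNReal.ofReal (Real.exp (-‖p.1 - p.2‖ ^ 2 / 2) / (2 * Real.pi) ^ ((n : ℝ) / 2))

open Classical in
/-- Relative entropy `H(p|r) = ∫ log (dp/dr) dp`, `+∞` if not absolutely continuous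
(or not integrable; the paper's definition requires an integrability condition as well). -/
noncomputable def relEnt {X : Type} [MeasurableSpace X] (p r : Measure X) : EReal :=
  if p ≪ r ∧ Integrable (fun x => Real.log (p.rnDeriv r x).toReal) p
  then ((∫ x, Real.log (p.rnDeriv r x).toReal ∂p : ℝ) : EReal) else ⊤

/-- `π` is a coupling of `μ0` and `μ1`. -/
def Coupling {X : Type} [MeasurableSpace X] (π : Measure (X × X)) (μ0 μ1 : Measure X) : Prop :=
  IsProbabilityMeasure π ∧ π.map Prod.fst = μ0 ∧ π.map Prod.snd = μ1

/-- Relative entropy of a measure with respect to Lebesgue, `∫ ρ log ρ` for the density `ρ`. -/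
noncomputable def entLeb (n : ℕ) (μ : Measure (Eucl n)) : ℝ :=
  ∫ x, (μ.rnDeriv volume x).toReal * Real.log ((μ.rnDeriv volume x).toReal)

/-- Entropic cost (EReal-valued):
`𝒜(μ0,μ1) = inf { H(π|R₀₁) } - (H(μ0|dx)+H(μ1|dx))/2`. -/
noncomputable def entCostE (n : ℕ) (μ0 μ1 : Measure (Eucl n)) : EReal :=
  (⨅ π : {π : Measure (Eucl n × Eucl n) // Coupling π μ0 μ1}, relEnt (π.1) (R01 n))
    - (((entLeb n μ0 + entLeb n μ1) / 2 : ℝ) : EReal)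

/-- Entropic cost, real-valued. -/
noncomputable def entCost (n : ℕ) (μ0 μ1 : Measure (Eucl n)) : ℝ :=
  (entCostE n μ0 μ1).toReal

/-- Squared quadratic Wasserstein distance. -/
noncomputable def W2sq (n : ℕ) (μ0 μ1 : Measure (Eucl n)) : ℝ :=
  (⨅ π : {π : Measure (Eucl n × Eucl n) // Coupling π μ0 μ1},
      ∫⁻ p, (‖p.1 - p.2‖₊ : ℝ≥0∞) ^ 2 ∂(π.1)).toReal

/-- `f` is (the function of) a Schwartz function. -/
def IsSchwartz (n : ℕ) (f : Eucl n → ℝ) : Prop :=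
  ∃ F : SchwartzMap (Eucl n) ℝ, ⇑F = f

/-- The pair `(μ0, μ1)` belongs to `Π_𝒮`: it admits a Schrödinger decomposition
`μ0 = f·T₁g dx`, `μ1 = g·T₁f dx` with `f, g` positive Schwartz functions bounded below
by a Gaussian. -/
def PiS (n : ℕ) (μ0 μ1 : Measure (Eucl n)) : Prop :=
  ∃ f g : Eucl n → ℝ, IsSchwartz n f ∧ IsSchwartz n g ∧
    (∀ x, 0 < f x) ∧ (∀ x, 0 < g x) ∧
    (∃ α c : ℝ, 0 < α ∧ 0 < c ∧ (∀ x, c * Real.exp (-α * ‖x‖ ^ 2) ≤ f x) ∧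
      (∀ x, c * Real.exp (-α * ‖x‖ ^ 2) ≤ g x)) ∧
    μ0 = densMeas n (fun x => f x * heat n 1 g x) ∧
    μ1 = densMeas n (fun x => g x * heat n 1 f x)

/-- Laplacian `Δφ = ∑ᵢ ∂²φ/∂xᵢ²`. -/
noncomputable def lap (n : ℕ) (φ : Eucl n → ℝ) (x : Eucl n) : ℝ :=
  ∑ i, fderiv ℝ (fun y => fderiv ℝ φ y (EuclideanSpace.single i 1)) x (EuclideanSpace.single i 1)

/-- Squared Hilbert-Schmidt norm of the Hessian, `‖Hess φ‖² = ∑ᵢⱼ (∂ᵢ∂ⱼφ)²`. -/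
noncomputable def hessHS (n : ℕ) (φ : Eucl n → ℝ) (x : Eucl n) : ℝ :=
  ∑ i, ∑ j, (fderiv ℝ (fun y => fderiv ℝ φ y (EuclideanSpace.single j 1)) x
    (EuclideanSpace.single i 1)) ^ 2

/-- Divergence `∇·F = ∑ᵢ ∂Fᵢ/∂xᵢ` of a vector field. -/
noncomputable def diverg (n : ℕ) (F : Eucl n → Eucl n) (x : Eucl n) : ℝ :=
  ∑ i, fderiv ℝ (fun y => F y i) x (EuclideanSpace.single i 1)

/-- Heat semigroup acting componentwise on vector-valued functions. -/
noncomputable def heatV (n : ℕ) (t : ℝ) (F : Eucl n → Eucl n) (x : Eucl n) : Eucl n :=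
  (EuclideanSpace.equiv (Fin n) ℝ).symm (fun i => heat n t (fun y => F y i) x)

/-- Entropic interpolation density `μ_s = T_s f · T_{1-s} g`. -/
noncomputable def entInterp (n : ℕ) (f g : Eucl n → ℝ) (s : ℝ) (x : Eucl n) : ℝ :=
  heat n s f x * heat n (1 - s) g x

/-- The potential `θ_s = (log T_{1-s} g - log T_s f)/2`, whose gradient drives the
transport equation of the entropic interpolation. -/
noncomputable def thetaPot (n : ℕ) (f g : Eucl n → ℝ) (s : ℝ) (x : Eucl n) : ℝ :=
  (Real.log (heat n (1 - s) g x) - Real.log (heat n s f x)) / 2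

end


/-- Continuous functions decaying faster than every power of `1 + ‖x‖²`. -/
def RapidDecay {n : ℕ} (w : Eucl n → ℝ) : Prop :=
  Continuous w ∧ ∀ k : ℕ, ∃ C : ℝ, ∀ x, (1 + ‖x‖ ^ 2) ^ k * |w x| ≤ C

/-- Continuous functions growing at most like a power of `1 + ‖x‖²`. -/
def PolyGrowth {n : ℕ} (w : Eucl n → ℝ) : Prop :=
  Continuous w ∧ ∃ (k : ℕ) (C : ℝ), ∀ x, |w x| ≤ C * (1 + ‖x‖ ^ 2) ^ k

section Decay

variable {n : ℕ} {v w : Eucl n → ℝ}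

lemma one_le_one_add_normSq_pow (x : Eucl n) (k : ℕ) : 1 ≤ (1 + ‖x‖ ^ 2) ^ k :=
  one_le_pow₀ (by nlinarith [sq_nonneg ‖x‖])

lemma one_add_normSq_le_mul (x y : Eucl n) :
    1 + ‖x + y‖ ^ 2 ≤ 2 * (1 + ‖x‖ ^ 2) * (1 + ‖y‖ ^ 2) := by
  have h := norm_add_le x y
  have h1 : ‖x + y‖ ^ 2 ≤ (‖x‖ + ‖y‖) ^ 2 := by gcongr
  nlinarith [sq_nonneg (‖x‖ - ‖y‖), mul_nonneg (sq_nonneg ‖x‖) (sq_nonneg ‖y‖)]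

lemma RapidDecay.exists_bound (hw : RapidDecay w) (k : ℕ) :
    ∃ C : ℝ, 0 ≤ C ∧ ∀ x, (1 + ‖x‖ ^ 2) ^ k * |w x| ≤ C := by
  obtain ⟨C, hC⟩ := hw.2 k
  exact ⟨C, le_trans (by positivity) (hC 0), hC⟩

lemma RapidDecay.bounded (hw : RapidDecay w) : ∃ C : ℝ, 0 ≤ C ∧ ∀ x, |w x| ≤ C := by
  obtain ⟨C, h0, hC⟩ := hw.exists_bound 0
  exact ⟨C, h0, fun x => by simpa using hC x⟩

lemma PolyGrowth.exists_bound (hw : PolyGrowth w) :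
    ∃ (k : ℕ) (C : ℝ), 0 ≤ C ∧ ∀ x, |w x| ≤ C * (1 + ‖x‖ ^ 2) ^ k := by
  obtain ⟨k, C, hC⟩ := hw.2
  refine ⟨k, |C|, abs_nonneg _, fun x => (hC x).trans ?_⟩
  gcongr
  exact le_abs_self C

lemma PolyGrowth.of_bounded (hw : Continuous w) {C : ℝ} (hC : ∀ x, |w x| ≤ C) :
    PolyGrowth w := ⟨hw, 0, C, by simpa using hC⟩

lemma RapidDecay.polyGrowth (hw : RapidDecay w) : PolyGrowth w := by
  obtain ⟨C, -, hC⟩ := hw.bounded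
  exact .of_bounded hw.1 hC

lemma PolyGrowth.const (c : ℝ) : PolyGrowth (fun _ : Eucl n => c) :=
  .of_bounded continuous_const (C := |c|) fun _ => le_rfl

lemma PolyGrowth.coord (i : Fin n) : PolyGrowth (fun x : Eucl n => x i) := by
  refine ⟨by fun_prop, 1, 1, fun x => ?_⟩
  have : |x i| ≤ ‖x‖ := by simpa using PiLp.norm_apply_le x i
  nlinarith [sq_nonneg (‖x‖ - 1), norm_nonneg x]

lemma PolyGrowth.mul (hv : PolyGrowth v) (hw : PolyGrowth w) :
    PolyGrowth (fun x => v x * w x) := by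
  obtain ⟨k, C, hC, h1⟩ := hv.exists_bound
  obtain ⟨l, D, hD, h2⟩ := hw.exists_bound
  refine ⟨hv.1.mul hw.1, k + l, C * D, fun x => ?_⟩
  rw [abs_mul, pow_add]
  calc |v x| * |w x| ≤ (C * (1 + ‖x‖ ^ 2) ^ k) * (D * (1 + ‖x‖ ^ 2) ^ l) := by
        gcongr
        exacts [h1 x, h2 x]
    _ = _ := by ring

lemma PolyGrowth.add (hv : PolyGrowth v) (hw : PolyGrowth w) :
    PolyGrowth (fun x => v x + w x) := by
  obtain ⟨k, C, hC, h1⟩ := hv.exists_bound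
  obtain ⟨l, D, hD, h2⟩ := hw.exists_bound
  refine ⟨hv.1.add hw.1, k + l, C + D, fun x => (abs_add_le _ _).trans ?_⟩
  have h3 := one_le_one_add_normSq_pow x k
  have h4 := one_le_one_add_normSq_pow x l
  rw [pow_add, add_mul]
  refine add_le_add ((h1 x).trans ?_) ((h2 x).trans ?_)
  · gcongr
    exact le_mul_of_one_le_right (by positivity) h4
  · gcongr
    exact le_mul_of_one_le_left (by positivity) h3

lemma PolyGrowth.const_mul (c : ℝ) (hw : PolyGrowth w) : PolyGrowth (fun x => c * w x) :=
  (PolyGrowth.const c).mul hw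

lemma PolyGrowth.neg (hw : PolyGrowth w) : PolyGrowth (fun x => -w x) := by
  simpa using hw.const_mul (-1)

lemma PolyGrowth.comp_affine (hw : PolyGrowth w) (x : Eucl n) (c : ℝ) :
    PolyGrowth (fun z => w (x + c • z)) := by
  obtain ⟨k, C, hC, h1⟩ := hw.exists_bound
  refine ⟨hw.1.comp (by fun_prop), k, C * (2 * (1 + ‖x‖ ^ 2) * (1 + c ^ 2)) ^ k, fun z => ?_⟩
  refine (h1 _).trans ?_
  rw [mul_assoc, ← mul_pow]
  gcongr
  refine (one_add_normSq_le_mul _ _).trans ?_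
  rw [norm_smul, mul_pow, mul_assoc]
  rw [mul_assoc (2 * (1 + ‖x‖ ^ 2)), mul_assoc 2]
  gcongr
  rw [Real.norm_eq_abs, sq_abs]
  nlinarith [sq_nonneg c, sq_nonneg ‖z‖]

lemma RapidDecay.mul_poly (hv : RapidDecay v) (hw : PolyGrowth w) :
    RapidDecay (fun x => v x * w x) := by
  obtain ⟨l, D, hD, h2⟩ := hw.exists_bound
  refine ⟨hv.1.mul hw.1, fun k => ?_⟩
  obtain ⟨C, hC, h1⟩ := hv.exists_bound (k + l)
  refine ⟨C * D, fun x => ?_⟩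
  rw [abs_mul]
  calc (1 + ‖x‖ ^ 2) ^ k * (|v x| * |w x|)
      ≤ (1 + ‖x‖ ^ 2) ^ k * (|v x| * (D * (1 + ‖x‖ ^ 2) ^ l)) := by gcongr; exact h2 x
    _ = ((1 + ‖x‖ ^ 2) ^ (k + l) * |v x|) * D := by rw [pow_add]; ring
    _ ≤ C * D := by gcongr; exact h1 x

lemma PolyGrowth.mul_rapid (hv : PolyGrowth v) (hw : RapidDecay w) :
    RapidDecay (fun x => v x * w x) := by
  simpa only [mul_comm] using hw.mul_poly hv

lemma RapidDecay.mul (hv : RapidDecay v) (hw : RapidDecay w) :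
    RapidDecay (fun x => v x * w x) := hv.mul_poly hw.polyGrowth

lemma RapidDecay.const_mul (c : ℝ) (hw : RapidDecay w) : RapidDecay (fun x => c * w x) :=
  (PolyGrowth.const c).mul_rapid hw

lemma RapidDecay.add (hv : RapidDecay v) (hw : RapidDecay w) :
    RapidDecay (fun x => v x + w x) := by
  refine ⟨hv.1.add hw.1, fun k => ?_⟩
  obtain ⟨C, hC, h1⟩ := hv.exists_bound k
  obtain ⟨D, hD, h2⟩ := hw.exists_bound k
  refine ⟨C + D, fun x => ?_⟩
  calc (1 + ‖x‖ ^ 2) ^ k * |v x + w x| ≤ (1 + ‖x‖ ^ 2) ^ k * (|v x| + |w x|) := by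
        gcongr; exact abs_add_le _ _
    _ ≤ C + D := by rw [mul_add]; exact add_le_add (h1 x) (h2 x)

lemma PolyGrowth.sub (hv : PolyGrowth v) (hw : PolyGrowth w) :
    PolyGrowth (fun x => v x - w x) := by
  simpa only [sub_eq_add_neg] using hv.add hw.neg

lemma RapidDecay.zero : RapidDecay (fun _ : Eucl n => (0 : ℝ)) :=
  ⟨continuous_const, fun _ => ⟨0, by simp⟩⟩

lemma RapidDecay.sum {ι : Type*} (s : Finset ι) {f : ι → Eucl n → ℝ}
    (hf : ∀ i ∈ s, RapidDecay (f i)) : RapidDecay (fun x => ∑ i ∈ s, f i x) := by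
  classical
  induction s using Finset.induction_on with
  | empty => simpa using RapidDecay.zero
  | insert a s ha ih =>
    simp only [Finset.sum_insert ha]
    exact (hf a (by simp)).add (ih fun i hi => hf i (by simp [hi]))

lemma integrable_one_add_normSq_pow_inv :
    Integrable (fun x : Eucl n => ((1 + ‖x‖ ^ 2) ^ (n + 1))⁻¹) := by
  have h := integrable_rpow_neg_one_add_norm_sq (E := Eucl n) (μ := volume)
    (r := 2 * ((n + 1 : ℕ) : ℝ)) (by simp; linarith)
  refine h.congr (Eventually.of_forall fun x => ?_)
  have : -(2 * ((n + 1 : ℕ) : ℝ)) / 2 = -((n + 1 : ℕ) : ℝ) := by ring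
  simp only [this]
  rw [Real.rpow_neg (by positivity), Real.rpow_natCast]

lemma abs_le_mul_inv_of_bound {k : ℕ} {C : ℝ} {x : Eucl n} {a : ℝ}
    (h : (1 + ‖x‖ ^ 2) ^ k * |a| ≤ C) : |a| ≤ C * ((1 + ‖x‖ ^ 2) ^ k)⁻¹ := by
  rw [← div_eq_mul_inv, le_div_iff₀ (by positivity)]
  linarith

lemma RapidDecay.integrable (hw : RapidDecay w) : Integrable w := by
  obtain ⟨C, -, hC⟩ := hw.exists_bound (n + 1)
  exact (integrable_one_add_normSq_pow_inv.const_mul C).mono' hw.1.aestronglyMeasurable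
    (Eventually.of_forall fun x => abs_le_mul_inv_of_bound (hC x))

lemma RapidDecay.mono (hw : RapidDecay w) (hv : Continuous v) (h : ∀ x, |v x| ≤ |w x|) :
    RapidDecay v := by
  refine ⟨hv, fun k => ?_⟩
  obtain ⟨C, -, hC⟩ := hw.exists_bound k
  exact ⟨C, fun x => (mul_le_mul_of_nonneg_left (h x) (by positivity)).trans (hC x)⟩

end Decay

/-- The standard Gaussian density. -/
noncomputable def gaussDens (n : ℕ) (z : Eucl n) : ℝ :=
  Real.exp (-‖z‖ ^ 2 / 2) / (2 * Real.pi) ^ ((n : ℝ) / 2)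

section Gauss

variable {n : ℕ}

lemma gaussDens_pos (z : Eucl n) : 0 < gaussDens n z := by
  unfold gaussDens; positivity

lemma gaussDens_neg (z : Eucl n) : gaussDens n (-z) = gaussDens n z := by
  simp [gaussDens]

lemma log_gaussDens (z : Eucl n) :
    Real.log (gaussDens n z) = -(n / 2 * Real.log (2 * Real.pi)) - ‖z‖ ^ 2 / 2 := by
  unfold gaussDens
  rw [Real.log_div (by positivity) (by positivity), Real.log_exp, Real.log_rpow (by positivity)]
  ring

lemma rapidDecay_exp_neg_normSq :
    RapidDecay (fun z : Eucl n => Real.exp (-‖z‖ ^ 2 / 2)) := by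
  refine ⟨by fun_prop, fun k => ⟨2 ^ k * k.factorial * Real.exp (1 / 2), fun z => ?_⟩⟩
  have h := Real.pow_div_factorial_le_exp ((1 + ‖z‖ ^ 2) / 2) (by positivity) k
  rw [div_le_iff₀ (by positivity), div_pow, div_le_iff₀ (by positivity)] at h
  rw [abs_of_pos (Real.exp_pos _)]
  calc _ ≤ (Real.exp ((1 + ‖z‖ ^ 2) / 2) * k.factorial * 2 ^ k) * Real.exp (-‖z‖ ^ 2 / 2) := by
        gcongr
    _ = 2 ^ k * k.factorial * (Real.exp ((1 + ‖z‖ ^ 2) / 2) * Real.exp (-‖z‖ ^ 2 / 2)) := by ring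
    _ = _ := by
        rw [← Real.exp_add]
        congr 2
        ring

lemma rapidDecay_gaussDens : RapidDecay (gaussDens n) := by
  have := (rapidDecay_exp_neg_normSq (n := n)).const_mul (((2 * Real.pi) ^ ((n : ℝ) / 2))⁻¹)
  unfold gaussDens
  simpa only [div_eq_inv_mul] using this

lemma integral_gaussDens : ∫ z, gaussDens n z = 1 := by
  have h := GaussianFourier.integral_rexp_neg_mul_sq_norm (V := Eucl n) (b := 1 / 2) (by norm_num)
  unfold gaussDens
  rw [integral_div]
  have h2 : ∀ z : Eucl n, -‖z‖ ^ 2 / 2 = -(1 / 2) * ‖z‖ ^ 2 := fun z => by ring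
  simp only [h2]
  rw [h, finrank_euclideanSpace_fin]
  rw [show Real.pi / (1 / 2) = 2 * Real.pi by ring]
  exact div_self (by positivity)

lemma PolyGrowth.integrable_mul_gaussDens {h : Eucl n → ℝ} (hh : PolyGrowth h) :
    Integrable (fun z => h z * gaussDens n z) :=
  (hh.mul_rapid rapidDecay_gaussDens).integrable

lemma hasFDerivAt_gaussDens (z : Eucl n) :
    HasFDerivAt (gaussDens n) (-gaussDens n z • innerSL ℝ z) z := by
  have h1 : HasFDerivAt (fun y : Eucl n => -‖y‖ ^ 2 / 2) (-innerSL ℝ z) z := by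
    have h := ((hasStrictFDerivAt_norm_sq z).hasFDerivAt).const_mul (-1 / 2 : ℝ)
    refine (h.congr_fderiv ?_).congr_of_eventuallyEq (Eventually.of_forall fun y => ?_)
    · ext y; simp; ring
    · simp only; ring
  have h2 := h1.exp.mul_const (((2 * Real.pi) ^ ((n : ℝ) / 2))⁻¹)
  refine (h2.congr_fderiv ?_).congr_of_eventuallyEq (Eventually.of_forall fun y => ?_)
  · ext y; simp [gaussDens, div_eq_mul_inv]; ring
  · simp [gaussDens, div_eq_mul_inv]

/-- Gaussian integration by parts. -/
lemma integral_mul_coord_gaussDens {h h' : Eucl n → ℝ} {i : Fin n} (hh : PolyGrowth h)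
    (hh' : PolyGrowth h')
    (hd : ∀ z, HasLineDerivAt ℝ h (h' z) z (EuclideanSpace.single i 1)) :
    ∫ z, h z * z i * gaussDens n z = ∫ z, h' z * gaussDens n z := by
  have hg : ∀ z : Eucl n, HasLineDerivAt ℝ (gaussDens n) (-(z i * gaussDens n z)) z
      (EuclideanSpace.single i 1) := fun z => by
    have := (hasFDerivAt_gaussDens z).hasLineDerivAt (EuclideanSpace.single i 1)
    have he : (-gaussDens n z • innerSL ℝ z) (EuclideanSpace.single i 1) =
        -(z i * gaussDens n z) := by
      simp [EuclideanSpace.inner_single_right, mul_comm]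
    exact he ▸ this
  have key := integral_bilinear_hasLineDerivAt_right_eq_neg_left_of_integrable
    (μ := (volume : Measure (Eucl n))) (f := h) (f' := h') (g := gaussDens n)
    (g' := fun z => -(z i * gaussDens n z)) (v := EuclideanSpace.single i 1)
    (B := ContinuousLinearMap.mul ℝ ℝ) ?_ ?_ ?_ (fun z _ => hd z) (fun z _ => hg z)
  · simp only [ContinuousLinearMap.mul_apply', mul_neg, integral_neg, neg_inj] at key
    rw [← key]
    exact integral_congr_ae (Eventually.of_forall fun z => by simp only; ring)
  · exact hh'.integrable_mul_gaussDens
  · have := (hh.mul (PolyGrowth.coord i).neg).integrable_mul_gaussDens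
    refine this.congr (Eventually.of_forall fun z => ?_)
    simp only [ContinuousLinearMap.mul_apply']; ring
  · exact hh.integrable_mul_gaussDens

end Gauss

/-- The partial derivative in the `i`-th coordinate direction. -/
noncomputable def pd {n : ℕ} (i : Fin n) (w : Eucl n → ℝ) (x : Eucl n) : ℝ :=
  fderiv ℝ w x (EuclideanSpace.single i 1)

/-- `w` and its partial derivatives up to order `k` satisfy `P`. -/
def Reg {n : ℕ} (P : (Eucl n → ℝ) → Prop) : ℕ → (Eucl n → ℝ) → Prop
  | 0, w => P w
  | k + 1, w => P w ∧ Differentiable ℝ w ∧ ∀ i, Reg P k (pd i w)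

section Regularity

variable {n : ℕ} {P Q R : (Eucl n → ℝ) → Prop} {v w : Eucl n → ℝ} {k : ℕ}

lemma Reg.base (hw : Reg P k w) : P w := by
  cases k with
  | zero => exact hw
  | succ k => exact hw.1

lemma Reg.differentiable (hw : Reg P (k + 1) w) : Differentiable ℝ w := hw.2.1

lemma Reg.pd (hw : Reg P (k + 1) w) (i : Fin n) : Reg P k (pd i w) := hw.2.2 i

lemma Reg.pred (hw : Reg P (k + 1) w) : Reg P k w := by
  induction k generalizing w with
  | zero => exact hw.1
  | succ k ih => exact ⟨hw.1, hw.2.1, fun i => ih (hw.2.2 i)⟩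

lemma Reg.mono (h : ∀ w, P w → Q w) (hw : Reg P k w) : Reg Q k w := by
  induction k generalizing w with
  | zero => exact h _ hw
  | succ k ih => exact ⟨h _ hw.1, hw.2.1, fun i => ih (hw.2.2 i)⟩

lemma pd_mul (hv : Differentiable ℝ v) (hw : Differentiable ℝ w) (i : Fin n) :
    pd i (fun x => v x * w x) = fun x => pd i v x * w x + v x * pd i w x := by
  funext x
  simp only [pd]
  rw [fderiv_fun_mul (hv x) (hw x)]
  simp
  ring

lemma pd_add (hv : Differentiable ℝ v) (hw : Differentiable ℝ w) (i : Fin n) :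
    pd i (fun x => v x + w x) = fun x => pd i v x + pd i w x := by
  funext x
  simp only [pd]
  rw [fderiv_fun_add (hv x) (hw x)]
  simp

lemma pd_const_mul (hw : Differentiable ℝ w) (c : ℝ) (i : Fin n) :
    pd i (fun x => c * w x) = fun x => c * pd i w x := by
  funext x
  simp only [pd]
  rw [fderiv_const_mul (hw x)]
  simp

lemma Reg.add (h : ∀ v w, P v → P w → P (fun x => v x + w x)) (hv : Reg P k v)
    (hw : Reg P k w) : Reg P k (fun x => v x + w x) := by
  induction k generalizing v w with
  | zero => exact h _ _ hv hw
  | succ k ih =>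
    refine ⟨h _ _ hv.1 hw.1, hv.2.1.add hw.2.1, fun i => ?_⟩
    rw [pd_add hv.2.1 hw.2.1]
    exact ih (hv.2.2 i) (hw.2.2 i)

lemma Reg.mul (hadd : ∀ v w, R v → R w → R (fun x => v x + w x))
    (hmul : ∀ v w, P v → Q w → R (fun x => v x * w x)) (hv : Reg P k v) (hw : Reg Q k w) :
    Reg R k (fun x => v x * w x) := by
  induction k generalizing v w with
  | zero => exact hmul _ _ hv hw
  | succ k ih =>
    refine ⟨hmul _ _ hv.1 hw.1, hv.2.1.mul hw.2.1, fun i => ?_⟩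
    rw [pd_mul hv.2.1 hw.2.1]
    exact (ih (hv.2.2 i) hw.pred).add hadd (ih hv.pred (hw.2.2 i))

lemma Reg.mul_poly (hv : Reg RapidDecay k v) (hw : Reg PolyGrowth k w) :
    Reg RapidDecay k (fun x => v x * w x) :=
  Reg.mul (fun _ _ => RapidDecay.add) (fun _ _ => RapidDecay.mul_poly) hv hw

lemma Reg.mul_rapid (hv : Reg RapidDecay k v) (hw : Reg RapidDecay k w) :
    Reg RapidDecay k (fun x => v x * w x) :=
  hv.mul_poly (hw.mono fun _ => RapidDecay.polyGrowth)

lemma Reg.const (c : ℝ) : Reg PolyGrowth k (fun _ : Eucl n => c) := by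
  induction k generalizing c with
  | zero => exact PolyGrowth.const c
  | succ k ih =>
    refine ⟨PolyGrowth.const c, differentiable_const c, fun i => ?_⟩
    have : _root_.pd i (fun _ : Eucl n => c) = fun _ => 0 := by
      funext x; simp [_root_.pd]
    rw [this]
    exact ih 0

lemma Reg.const_mul (c : ℝ) (hw : Reg RapidDecay k w) : Reg RapidDecay k (fun x => c * w x) := by
  simpa only [mul_comm] using hw.mul_poly (.const c)

lemma reg_coord_sub (y : Eucl n) (i : Fin n) :
    Reg PolyGrowth k (fun x : Eucl n => y i - x i) := by
  have hP : PolyGrowth (fun x : Eucl n => y i - x i) := (PolyGrowth.const _).sub (.coord i)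
  cases k with
  | zero => exact hP
  | succ k =>
    refine ⟨hP, by fun_prop, fun j => ?_⟩
    have : pd j (fun x : Eucl n => y i - x i) =
        fun _ => -((EuclideanSpace.single j (1 : ℝ) : Eucl n) i) := by
      funext x
      have h : HasFDerivAt (fun x : Eucl n => y i - x i)
          (-(EuclideanSpace.proj i : Eucl n →L[ℝ] ℝ)) x :=
        ((EuclideanSpace.proj i : Eucl n →L[ℝ] ℝ).hasFDerivAt).const_sub (y i)
      simp [pd, h.fderiv]
    rw [this]
    exact .const _

lemma hasFDerivAt_gaussDens_sub (x y : Eucl n) :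
    HasFDerivAt (fun x => gaussDens n (x - y)) (-gaussDens n (x - y) • innerSL ℝ (x - y)) x :=
  (HasFDerivAt.comp x (f := fun x => x - y) (hasFDerivAt_gaussDens (x - y))
    ((hasFDerivAt_id x).sub_const y)).congr_fderiv (by ext; simp)

lemma pd_gaussDens_sub (y : Eucl n) (i : Fin n) :
    pd i (fun x => gaussDens n (x - y)) = fun x => (y i - x i) * gaussDens n (x - y) := by
  funext x
  rw [pd, (hasFDerivAt_gaussDens_sub x y).fderiv]
  simp [EuclideanSpace.inner_single_right]
  ring

lemma reg_gaussDens_sub (y : Eucl n) : Reg PolyGrowth k (fun x => gaussDens n (x - y)) := by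
  have hP : PolyGrowth (fun x => gaussDens n (x - y)) := by
    have := rapidDecay_gaussDens (n := n).polyGrowth.comp_affine (-y) 1
    simpa [sub_eq_neg_add] using this
  induction k with
  | zero => exact hP
  | succ k ih =>
    refine ⟨hP, fun x => (hasFDerivAt_gaussDens_sub x y).differentiableAt, fun i => ?_⟩
    rw [pd_gaussDens_sub]
    exact Reg.mul (fun _ _ => PolyGrowth.add) (fun _ _ => PolyGrowth.mul) (reg_coord_sub y i) ih

lemma SchwartzMap.rapidDecay (f : SchwartzMap (Eucl n) ℝ) : RapidDecay (f : Eucl n → ℝ) := by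
  refine ⟨f.continuous, fun k => ?_⟩
  obtain ⟨C, hC⟩ : ∃ C : ℝ, ∀ x, (1 + ‖x‖) ^ (2 * k) * ‖f x‖ ≤ C :=
    ⟨_, fun x => by
      simpa using SchwartzMap.one_add_le_sup_seminorm_apply (𝕜 := ℝ) (m := (2 * k, 0))
        (k := 2 * k) (n := 0) le_rfl le_rfl f x⟩
  refine ⟨C, fun x => le_trans ?_ (hC x)⟩
  rw [pow_mul]
  simp only [Real.norm_eq_abs]
  gcongr
  nlinarith [norm_nonneg x]

lemma SchwartzMap.reg (f : SchwartzMap (Eucl n) ℝ) (k : ℕ) :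
    Reg RapidDecay k (f : Eucl n → ℝ) := by
  induction k generalizing f with
  | zero => exact f.rapidDecay
  | succ k ih =>
    refine ⟨f.rapidDecay, f.differentiable, fun i => ?_⟩
    have : pd i (f : Eucl n → ℝ) =
        (LineDeriv.lineDerivOp (EuclideanSpace.single i (1 : ℝ)) f : SchwartzMap (Eucl n) ℝ) := by
      funext x
      rw [SchwartzMap.lineDerivOp_apply_eq_fderiv]
      rfl
    rw [this]
    exact ih _

lemma hasFDerivAt_eq_sum_pd (hw : Differentiable ℝ w) (x : Eucl n) :
    HasFDerivAt w (∑ i, pd i w x • (EuclideanSpace.proj i : Eucl n →L[ℝ] ℝ)) x := by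
  refine (hw x).hasFDerivAt.congr_fderiv ?_
  ext y
  have : y = ∑ i, y i • (EuclideanSpace.single i (1 : ℝ) : Eucl n) := by
    ext j; simp [Finset.sum_apply, Pi.single_apply]
  conv_lhs => rw [this]
  simp [pd, mul_comm]

lemma hasLineDerivAt_pd (hw : Differentiable ℝ w) (x : Eucl n) (i : Fin n) :
    HasLineDerivAt ℝ w (pd i w x) x (EuclideanSpace.single i 1) :=
  (hw x).hasFDerivAt.hasLineDerivAt _

lemma pd_eq_of_hasFDerivAt {L : Eucl n →L[ℝ] ℝ} {x : Eucl n} (h : HasFDerivAt w L x)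
    (i : Fin n) : pd i w x = L (EuclideanSpace.single i 1) := by
  rw [pd, h.fderiv]

/-- Integration by parts in a coordinate direction. -/
lemma integral_mul_pd_eq_neg {f f' g : Eucl n → ℝ} {i : Fin n} (hg : Differentiable ℝ g)
    (hf : ∀ x, HasLineDerivAt ℝ f (f' x) x (EuclideanSpace.single i 1))
    (h1 : Integrable fun x => f' x * g x) (h2 : Integrable fun x => f x * pd i g x)
    (h3 : Integrable fun x => f x * g x) :
    ∫ x, f x * pd i g x = -∫ x, f' x * g x :=
  integral_bilinear_hasLineDerivAt_right_eq_neg_left_of_integrable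
    (μ := (volume : Measure (Eucl n))) (B := ContinuousLinearMap.mul ℝ ℝ)
    (v := EuclideanSpace.single i 1) h1 h2 h3 (fun x _ => hf x)
    (fun x _ => hasLineDerivAt_pd hg x i)

lemma integral_pd_eq_zero {g : Eucl n → ℝ} {i : Fin n} (hg : Reg RapidDecay 1 g) :
    ∫ x, pd i g x = 0 := by
  have := integral_mul_pd_eq_neg (f := fun _ => 1) (f' := fun _ => 0) (i := i) hg.differentiable
    (fun x => by
      simpa using (hasFDerivAt_const (1 : ℝ) x).hasLineDerivAt (EuclideanSpace.single i (1 : ℝ)))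
    (by simp) (by simpa using (hg.pd i).base.integrable)
    (by simpa using hg.base.integrable)
  simpa using this

end Regularity

/-- `∫ w(x + c z) κ(z) dz`, the average of `w` around `x` at scale `c` against the kernel `κ`. -/
noncomputable def kconv {n : ℕ} (κ : Eucl n → ℝ) (c : ℝ) (w : Eucl n → ℝ) (x : Eucl n) : ℝ :=
  ∫ z, w (x + c • z) * κ z

section KernelAverage

variable {n : ℕ} {κ w : Eucl n → ℝ}

lemma RapidDecay.shift_bound (hw : RapidDecay w) (S : ℝ) (k : ℕ) :
    ∃ C : ℝ, 0 ≤ C ∧ ∀ c x z, c ^ 2 ≤ S →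
      (1 + ‖x‖ ^ 2) ^ k * |w (x + c • z)| ≤ C * (1 + ‖z‖ ^ 2) ^ k := by
  obtain ⟨C, hC, h⟩ := hw.exists_bound k
  refine ⟨(2 * (1 + |S|)) ^ k * C, by positivity, fun c x z hc => ?_⟩
  have h1 : 1 + ‖x‖ ^ 2 ≤ 2 * (1 + |S|) * (1 + ‖z‖ ^ 2) * (1 + ‖x + c • z‖ ^ 2) := by
    have h2 := one_add_normSq_le_mul (x + c • z) (-(c • z))
    rw [add_neg_cancel_right, norm_neg, norm_smul, mul_pow, Real.norm_eq_abs, sq_abs] at h2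
    refine h2.trans ?_
    have h3 : 1 + c ^ 2 * ‖z‖ ^ 2 ≤ (1 + |S|) * (1 + ‖z‖ ^ 2) := by
      have := le_abs_self S
      nlinarith [sq_nonneg ‖z‖, abs_nonneg S,
        mul_nonneg (sub_nonneg.2 (hc.trans this)) (sq_nonneg ‖z‖)]
    calc _ ≤ 2 * (1 + ‖x + c • z‖ ^ 2) * ((1 + |S|) * (1 + ‖z‖ ^ 2)) := by gcongr
      _ = _ := by ring
  calc (1 + ‖x‖ ^ 2) ^ k * |w (x + c • z)|
      ≤ (2 * (1 + |S|) * (1 + ‖z‖ ^ 2) * (1 + ‖x + c • z‖ ^ 2)) ^ k * |w (x + c • z)| := by gcongr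
    _ = (2 * (1 + |S|)) ^ k * (1 + ‖z‖ ^ 2) ^ k *
        ((1 + ‖x + c • z‖ ^ 2) ^ k * |w (x + c • z)|) := by rw [mul_pow, mul_pow]; ring
    _ ≤ (2 * (1 + |S|)) ^ k * (1 + ‖z‖ ^ 2) ^ k * C := by gcongr; exact h _
    _ = _ := by ring

lemma integrable_kconv (hκ : RapidDecay κ) (hw : PolyGrowth w) (c : ℝ) (x : Eucl n) :
    Integrable (fun z => w (x + c • z) * κ z) :=
  ((hw.comp_affine x c).mul_rapid hκ).integrable

lemma polyGrowth_one_add_normSq_pow (k : ℕ) :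
    PolyGrowth (fun z : Eucl n => (1 + ‖z‖ ^ 2) ^ k) :=
  ⟨by fun_prop, k, 1, fun x => by rw [abs_of_nonneg (by positivity), one_mul]⟩

lemma RapidDecay.abs (hw : RapidDecay w) : RapidDecay (fun x => |w x|) :=
  hw.mono (continuous_abs.comp hw.1) fun x => by simp

lemma kconv_bound (hκ : RapidDecay κ) (hw : RapidDecay w) (S : ℝ) (k : ℕ) :
    ∃ C : ℝ, 0 ≤ C ∧ ∀ c x, c ^ 2 ≤ S → (1 + ‖x‖ ^ 2) ^ k * |kconv κ c w x| ≤ C := by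
  obtain ⟨C, hC, h⟩ := hw.shift_bound S k
  refine ⟨∫ z, C * ((1 + ‖z‖ ^ 2) ^ k * |κ z|), by positivity, fun c x hc => ?_⟩
  have hi := ((polyGrowth_one_add_normSq_pow (n := n) k).mul_rapid hκ.abs).integrable.const_mul C
  calc (1 + ‖x‖ ^ 2) ^ k * |kconv κ c w x|
      = |∫ z, (1 + ‖x‖ ^ 2) ^ k * (w (x + c • z) * κ z)| := by
        rw [integral_const_mul, abs_mul, abs_of_nonneg (by positivity : 0 ≤ (1 + ‖x‖ ^ 2) ^ k)]
        rfl
    _ ≤ ∫ z, |(1 + ‖x‖ ^ 2) ^ k * (w (x + c • z) * κ z)| := abs_integral_le_integral_abs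
    _ ≤ _ := by
        refine integral_mono ((integrable_kconv hκ hw.polyGrowth c x).const_mul _).abs hi
          fun z => ?_
        simp only
        rw [abs_mul, abs_mul, abs_of_nonneg (by positivity : 0 ≤ (1 + ‖x‖ ^ 2) ^ k), ← mul_assoc,
          ← mul_assoc]
        exact mul_le_mul_of_nonneg_right (h c x z hc) (abs_nonneg _)

lemma continuous_kconv (hκ : RapidDecay κ) (hw : RapidDecay w) :
    Continuous (fun p : ℝ × Eucl n => kconv κ p.1 w p.2) := by
  obtain ⟨C, -, hC⟩ := hw.bounded
  unfold kconv
  refine continuous_of_dominated (bound := fun z => C * |κ z|) (fun p => ?_) (fun p => ?_)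
    (hκ.abs.integrable.const_mul C) ?_
  · exact (integrable_kconv hκ hw.polyGrowth _ _).aestronglyMeasurable
  · refine Eventually.of_forall fun z => ?_
    rw [Real.norm_eq_abs, abs_mul]
    exact mul_le_mul_of_nonneg_right (hC _) (abs_nonneg _)
  · refine Eventually.of_forall fun z => ?_
    have := hw.1
    fun_prop

lemma RapidDecay.kernelAvg (hκ : RapidDecay κ) (hw : RapidDecay w) (c : ℝ) :
    RapidDecay (kconv κ c w) := by
  refine ⟨(continuous_kconv hκ hw).comp (by fun_prop : Continuous fun x : Eucl n => (c, x)),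
    fun k => ?_⟩
  obtain ⟨C, -, h⟩ := kconv_bound hκ hw (c ^ 2) k
  exact ⟨C, fun x => h c x le_rfl⟩

lemma exists_fderiv_bound (hw : Reg RapidDecay 1 w) :
    ∃ C : ℝ, 0 ≤ C ∧ ∀ x, ‖∑ i, pd i w x • (EuclideanSpace.proj i : Eucl n →L[ℝ] ℝ)‖ ≤ C := by
  choose C hC h using fun i => (hw.pd i).base.bounded
  refine ⟨∑ i, C i * ‖(EuclideanSpace.proj i : Eucl n →L[ℝ] ℝ)‖,
    Finset.sum_nonneg fun i _ => mul_nonneg (hC i) (norm_nonneg _), fun x => ?_⟩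
  refine (norm_sum_le _ _).trans (Finset.sum_le_sum fun i _ => ?_)
  rw [norm_smul]
  exact mul_le_mul_of_nonneg_right (h i x) (norm_nonneg _)

lemma hasFDerivAt_kconv (hκ : RapidDecay κ) (hw : Reg RapidDecay 1 w) (c : ℝ) (x : Eucl n) :
    HasFDerivAt (kconv κ c w)
      (∑ i, kconv κ c (pd i w) x • (EuclideanSpace.proj i : Eucl n →L[ℝ] ℝ)) x := by
  obtain ⟨C, hC, h⟩ := exists_fderiv_bound hw
  have hci : ∀ i, Integrable (fun z => pd i w (x + c • z) * κ z) := fun i =>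
    integrable_kconv hκ (hw.pd i).base.polyGrowth c x
  have key := hasFDerivAt_integral_of_dominated_of_fderiv_le (μ := (volume : Measure (Eucl n)))
    (F := fun y z => w (y + c • z) * κ z) (x₀ := x) (s := univ) (𝕜 := ℝ)
    (F' := fun y z => κ z • ∑ i, pd i w (y + c • z) • (EuclideanSpace.proj i : Eucl n →L[ℝ] ℝ))
    (bound := fun z => C * |κ z|) Filter.univ_mem
    (Eventually.of_forall fun y =>
      (integrable_kconv hκ hw.base.polyGrowth c y).aestronglyMeasurable)
    (integrable_kconv hκ hw.base.polyGrowth c x) ?_ ?_ (hκ.abs.integrable.const_mul C) ?_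
  · refine key.congr_fderiv ?_
    simp only [Finset.smul_sum, smul_smul]
    rw [integral_finsetSum]
    · refine Finset.sum_congr rfl fun i _ => ?_
      rw [integral_smul_const]
      simp only [kconv, mul_comm]
    · intro i _
      refine Integrable.smul_const ?_ _
      simpa only [mul_comm] using hci i
  · have : Continuous (fun z => κ z • ∑ i, pd i w (x + c • z) •
        (EuclideanSpace.proj i : Eucl n →L[ℝ] ℝ)) := by
      refine hκ.1.smul (continuous_finsetSum _ fun i _ => ?_)
      exact (((hw.pd i).base.1).comp (by fun_prop)).smul continuous_const
    exact this.aestronglyMeasurable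
  · refine Eventually.of_forall fun z y _ => ?_
    rw [norm_smul, mul_comm, Real.norm_eq_abs]
    exact mul_le_mul_of_nonneg_right (h _) (abs_nonneg _)
  · refine Eventually.of_forall fun z y _ => ?_
    have h1 := (hasFDerivAt_eq_sum_pd hw.differentiable (y + c • z))
    have h2 := (h1.comp y (f := fun y => y + c • z)
      ((hasFDerivAt_id y).add_const (c • z))).mul_const (κ z)
    exact h2.congr_fderiv (by ext; simp)

lemma pd_kconv (hκ : RapidDecay κ) (hw : Reg RapidDecay 1 w) (c : ℝ) (i : Fin n) :
    pd i (kconv κ c w) = kconv κ c (pd i w) := by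
  funext x
  rw [pd_eq_of_hasFDerivAt (hasFDerivAt_kconv hκ hw c x)]
  simp

lemma Reg.kernelAvg (hκ : RapidDecay κ) {k : ℕ} (hw : Reg RapidDecay k w) (c : ℝ) :
    Reg RapidDecay k (kconv κ c w) := by
  induction k generalizing w with
  | zero => exact RapidDecay.kernelAvg hκ hw c
  | succ k ih =>
    have h1 : Reg RapidDecay 1 w := ⟨hw.1, hw.2.1, fun i => (hw.2.2 i).base⟩
    refine ⟨RapidDecay.kernelAvg hκ hw.1 c,
      fun x => (hasFDerivAt_kconv hκ h1 c x).differentiableAt, fun i => ?_⟩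
    rw [pd_kconv hκ h1]
    exact ih (hw.2.2 i)

lemma RapidDecay.coord_mul (hκ : RapidDecay κ) (i : Fin n) : RapidDecay (fun z => z i * κ z) :=
  (PolyGrowth.coord i).mul_rapid hκ

lemma hasDerivAt_kconv (hκ : RapidDecay κ) (hw : Reg RapidDecay 1 w) (c : ℝ) (x : Eucl n) :
    HasDerivAt (fun c => kconv κ c w x)
      (∑ i, kconv (fun z => z i * κ z) c (pd i w) x) c := by
  choose C hC h using fun i => (hw.pd i).base.bounded
  have hint := fun i => integrable_kconv (hκ.coord_mul i) (hw.pd i).base.polyGrowth c x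
  have key := hasDerivAt_integral_of_dominated_loc_of_deriv_le (μ := (volume : Measure (Eucl n)))
    (F := fun c z => w (x + c • z) * κ z) (x₀ := c) (s := univ) (𝕜 := ℝ)
    (F' := fun c z => ∑ i, pd i w (x + c • z) * (z i * κ z))
    (bound := fun z => ∑ i, C i * |z i * κ z|) Filter.univ_mem
    (Eventually.of_forall fun c =>
      (integrable_kconv hκ hw.base.polyGrowth c x).aestronglyMeasurable)
    (integrable_kconv hκ hw.base.polyGrowth c x)
    (integrable_finsetSum _ fun i _ => hint i).aestronglyMeasurable
    (Eventually.of_forall fun z c _ => ?_)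
    (integrable_finsetSum _ fun i _ => (hκ.coord_mul i).abs.integrable.const_mul _)
    (Eventually.of_forall fun z c _ => ?_)
  · have h2 := key.2
    rw [integral_finsetSum _ fun i _ => hint i] at h2
    exact h2
  · rw [Real.norm_eq_abs]
    refine (Finset.abs_sum_le_sum_abs _ _).trans (Finset.sum_le_sum fun i _ => ?_)
    rw [abs_mul]
    exact mul_le_mul_of_nonneg_right (h i _) (abs_nonneg _)
  · have h1 := hasFDerivAt_eq_sum_pd hw.differentiable (x + c • z)
    have h2 : HasDerivAt (fun c : ℝ => x + c • z) z c := by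
      simpa using ((hasDerivAt_id c).smul_const z).const_add x
    refine ((h1.comp_hasDerivAt c h2).mul_const (κ z)).congr_deriv ?_
    simp [Finset.sum_mul, mul_assoc]

lemma integrable_shift_mul {p : Eucl n → ℝ} (hκ : RapidDecay κ) (hp : PolyGrowth p)
    (hw : RapidDecay w) (c : ℝ) :
    Integrable (fun q : Eucl n × Eucl n => p (q.1 + c • q.2) * κ q.2 * w q.1)
      (volume.prod volume) := by
  obtain ⟨k, C, hC, hpb⟩ := hp.exists_bound
  have hdom : Integrable (fun q : Eucl n × Eucl n => C * (2 * (1 + c ^ 2)) ^ k *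
      (((1 + ‖q.1‖ ^ 2) ^ k * |w q.1|) * ((1 + ‖q.2‖ ^ 2) ^ k * |κ q.2|)))
      (volume.prod volume) :=
    (((polyGrowth_one_add_normSq_pow (n := n) k).mul_rapid hw.abs).integrable.mul_prod
      ((polyGrowth_one_add_normSq_pow (n := n) k).mul_rapid
          hκ.abs).integrable).const_mul _
  refine hdom.mono' ?_ (Eventually.of_forall fun q => ?_)
  · have h1 := hp.1
    have h2 := hw.1
    have h3 := hκ.1
    exact (by fun_prop : Continuous fun q : Eucl n × Eucl n =>
      p (q.1 + c • q.2) * κ q.2 * w q.1).aestronglyMeasurable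
  · rw [Real.norm_eq_abs, abs_mul, abs_mul]
    have h1 : |p (q.1 + c • q.2)| ≤
        C * ((2 * (1 + c ^ 2)) ^ k * (1 + ‖q.1‖ ^ 2) ^ k * (1 + ‖q.2‖ ^ 2) ^ k) := by
      refine (hpb _).trans ?_
      rw [← mul_pow, ← mul_pow]
      gcongr
      refine (one_add_normSq_le_mul _ _).trans ?_
      rw [norm_smul, mul_pow, Real.norm_eq_abs, sq_abs]
      have : 1 + c ^ 2 * ‖q.2‖ ^ 2 ≤ (1 + c ^ 2) * (1 + ‖q.2‖ ^ 2) := by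
        nlinarith [sq_nonneg c, sq_nonneg ‖q.2‖]
      calc _ ≤ 2 * (1 + ‖q.1‖ ^ 2) * ((1 + c ^ 2) * (1 + ‖q.2‖ ^ 2)) := by gcongr
        _ = _ := by ring
    calc _ ≤ C * ((2 * (1 + c ^ 2)) ^ k * (1 + ‖q.1‖ ^ 2) ^ k * (1 + ‖q.2‖ ^ 2) ^ k) *
          |κ q.2| * |w q.1| := by gcongr
      _ = _ := by ring

/-- Moving a symmetric kernel average to the other factor. -/
lemma integral_mul_kconv {p : Eucl n → ℝ} (hκ : RapidDecay κ) (hsymm : ∀ z, κ (-z) = κ z)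
    (hp : PolyGrowth p) (hw : RapidDecay w) (c : ℝ) :
    ∫ x, p x * kconv κ c w x = ∫ x, kconv κ c p x * w x := by
  have hint : Integrable (fun q : Eucl n × Eucl n => p q.1 * (w (q.1 + c • q.2) * κ q.2))
      (volume.prod volume) := by
    obtain ⟨k, C, hC, hpb⟩ := hp.exists_bound
    obtain ⟨D, hD, hwb⟩ := hw.shift_bound (c ^ 2) (k + (n + 1))
    have hdom : Integrable (fun q : Eucl n × Eucl n => C * D * (((1 + ‖q.1‖ ^ 2) ^ (n + 1))⁻¹ *
        ((1 + ‖q.2‖ ^ 2) ^ (k + (n + 1)) * |κ q.2|))) (volume.prod volume) :=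
      ((integrable_one_add_normSq_pow_inv (n := n)).mul_prod
        ((polyGrowth_one_add_normSq_pow (n := n) (k + (n + 1))).mul_rapid
          hκ.abs).integrable).const_mul _
    refine hdom.mono' ?_ (Eventually.of_forall fun q => ?_)
    · have h1 := hp.1
      have h2 := hw.1
      have h3 := hκ.1
      exact (by fun_prop : Continuous fun q : Eucl n × Eucl n =>
        p q.1 * (w (q.1 + c • q.2) * κ q.2)).aestronglyMeasurable
    · have h1 := abs_le_mul_inv_of_bound (hwb c q.1 q.2 le_rfl)
      rw [Real.norm_eq_abs, abs_mul, abs_mul]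
      calc |p q.1| * (|w (q.1 + c • q.2)| * |κ q.2|)
          ≤ (C * (1 + ‖q.1‖ ^ 2) ^ k) * (D * (1 + ‖q.2‖ ^ 2) ^ (k + (n + 1)) *
            ((1 + ‖q.1‖ ^ 2) ^ (k + (n + 1)))⁻¹ * |κ q.2|) := by
              gcongr
              exact hpb _
        _ = _ := by
              rw [pow_add (1 + ‖q.1‖ ^ 2)]
              field_simp
  have hint2 := integrable_shift_mul hκ hp hw c
  calc ∫ x, p x * kconv κ c w x = ∫ x, ∫ z, p x * (w (x + c • z) * κ z) := by
        simp only [kconv, integral_const_mul]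
    _ = ∫ z, ∫ x, p x * (w (x + c • z) * κ z) := integral_integral_swap hint
    _ = ∫ z, ∫ x, p (x - c • z) * (w x * κ z) := by
        refine integral_congr_ae (Eventually.of_forall fun z => ?_)
        simp only
        rw [← integral_add_right_eq_self (fun x => p (x - c • z) * (w x * κ z)) (c • z)]
        simp
    _ = ∫ z, ∫ x, p (x + c • z) * κ z * w x := by
        rw [← integral_neg_eq_self]
        refine integral_congr_ae (Eventually.of_forall fun z => ?_)
        simp only [hsymm, smul_neg, sub_neg_eq_add]
        refine integral_congr_ae (Eventually.of_forall fun x => ?_)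
        simp only
        ring
    _ = ∫ x, ∫ z, p (x + c • z) * κ z * w x := (integral_integral_swap hint2).symm
    _ = _ := by simp only [kconv, integral_mul_const]

end KernelAverage

/-- Gaussian convolution `∫ w(x + √s z) γ(z) dz`, the heat flow at time `s`. -/
noncomputable def gaussConv {n : ℕ} (s : ℝ) (w : Eucl n → ℝ) (x : Eucl n) : ℝ :=
  kconv (gaussDens n) (√s) w x

/-- Functions all of whose derivatives decay rapidly, and which dominate a Gaussian. -/
structure Nice {n : ℕ} (w : Eucl n → ℝ) : Prop where
  reg : ∀ k, Reg RapidDecay k w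
  lower : ∃ α c : ℝ, 0 < α ∧ 0 < c ∧ ∀ x, c * Real.exp (-α * ‖x‖ ^ 2) ≤ w x

section GaussConv

variable {n : ℕ} {p v w : Eucl n → ℝ}

lemma gaussConv_zero (w : Eucl n → ℝ) : gaussConv 0 w = w := by
  funext x
  simp [gaussConv, kconv, integral_const_mul, integral_gaussDens]

lemma heat_eq_gaussConv {s : ℝ} (hs : 0 ≤ s) (w : Eucl n → ℝ) : heat n s w = gaussConv s w := by
  funext x
  rcases hs.eq_or_lt with rfl | hs
  · simp [heat, gaussConv_zero]
  rw [heat, if_neg hs.ne', gaussConv, kconv]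
  have h0 : 0 < √s := Real.sqrt_pos.2 hs
  have h1 := Measure.integral_comp_smul (volume : Measure (Eucl n))
    (fun z => w (x + z) * gaussDens n ((√s)⁻¹ • z)) (√s)
  simp only [smul_smul, inv_mul_cancel₀ h0.ne', one_smul] at h1
  rw [h1, finrank_euclideanSpace_fin, smul_eq_mul, ← integral_const_mul,
    ← integral_add_left_eq_self (fun y : Eucl n => w y * _ / _) x]
  refine integral_congr_ae (Eventually.of_forall fun y => ?_)
  have h2 : (√s) ^ n = s ^ ((n : ℝ) / 2) := by
    rw [Real.sqrt_eq_rpow, ← Real.rpow_natCast, ← Real.rpow_mul hs.le]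
    congr 1
    ring
  have h3 : -‖(√s)⁻¹ • y‖ ^ 2 / 2 = -‖x - (x + y)‖ ^ 2 / (2 * s) := by
    rw [norm_smul, mul_pow, norm_inv, Real.norm_eq_abs, inv_pow, sq_abs, Real.sq_sqrt hs.le,
      sub_add_cancel_left, norm_neg]
    field_simp
  simp only [gaussDens, h3, h2]
  rw [Real.mul_rpow (by positivity) hs.le, abs_of_pos (by positivity)]
  field_simp

lemma RapidDecay.conv (hw : RapidDecay w) (s : ℝ) : RapidDecay (gaussConv s w) :=
  RapidDecay.kernelAvg rapidDecay_gaussDens hw _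

lemma Reg.conv {k : ℕ} (hw : Reg RapidDecay k w) (s : ℝ) :
    Reg RapidDecay k (gaussConv s w) :=
  Reg.kernelAvg rapidDecay_gaussDens hw _

lemma pd_gaussConv (hw : Reg RapidDecay 1 w) (s : ℝ) (i : Fin n) :
    pd i (gaussConv s w) = gaussConv s (pd i w) :=
  pd_kconv rapidDecay_gaussDens hw _ i

lemma continuous_gaussConv (hw : RapidDecay w) :
    Continuous (fun q : ℝ × Eucl n => gaussConv q.1 w q.2) :=
  (continuous_kconv rapidDecay_gaussDens hw).comp
    (by fun_prop : Continuous fun q : ℝ × Eucl n => (√q.1, q.2))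

lemma gaussConv_bound (hw : RapidDecay w) {S : ℝ} (hS : 0 ≤ S) (k : ℕ) :
    ∃ C : ℝ, 0 ≤ C ∧ ∀ s x, s ≤ S → (1 + ‖x‖ ^ 2) ^ k * |gaussConv s w x| ≤ C := by
  obtain ⟨C, hC, h⟩ := kconv_bound rapidDecay_gaussDens hw S k
  refine ⟨C, hC, fun s x hs => h _ x ?_⟩
  rcases le_total 0 s with h0 | h0
  · rwa [Real.sq_sqrt h0]
  · simpa [Real.sqrt_eq_zero_of_nonpos h0] using hS

lemma integral_mul_gaussConv (hp : PolyGrowth p) (hw : RapidDecay w) (s : ℝ) :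
    ∫ x, p x * gaussConv s w x = ∫ x, gaussConv s p x * w x :=
  integral_mul_kconv rapidDecay_gaussDens gaussDens_neg hp hw _

lemma gaussConv_const (c s : ℝ) (x : Eucl n) : gaussConv s (fun _ => c) x = c := by
  simp [gaussConv, kconv, integral_const_mul, integral_gaussDens]

lemma integral_gaussConv (hw : RapidDecay w) (s : ℝ) : ∫ x, gaussConv s w x = ∫ x, w x := by
  have := integral_mul_gaussConv (.const 1) hw s
  simpa [gaussConv_const] using this

lemma hasLineDerivAt_comp_affine (hw : Differentiable ℝ w) (c : ℝ) (x z : Eucl n) (i : Fin n) :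
    HasLineDerivAt ℝ (fun z => w (x + c • z)) (c * pd i w (x + c • z)) z
      (EuclideanSpace.single i 1) := by
  have h := (hw (x + c • z)).hasFDerivAt.comp z (f := fun z => x + c • z)
    (((hasFDerivAt_id z).const_smul c).const_add x)
  have h2 := h.hasLineDerivAt (EuclideanSpace.single i 1)
  refine HasDerivAt.congr_deriv h2 ?_
  simp [pd]

/-- Gaussian integration by parts for a kernel average. -/
lemma kconv_coord_gaussDens (hw : Reg RapidDecay 1 w) (c : ℝ) (x : Eucl n) (i : Fin n) :
    kconv (fun z => z i * gaussDens n z) c w x = c * kconv (gaussDens n) c (pd i w) x := by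
  have h := integral_mul_coord_gaussDens (hw.base.polyGrowth.comp_affine x c)
    (((hw.pd i).base.polyGrowth.comp_affine x c).const_mul c)
    (fun z => hasLineDerivAt_comp_affine hw.differentiable c x z i)
  simp only [kconv, ← integral_const_mul, ← mul_assoc]
  exact h

lemma kconv_coord_sq_gaussDens (hw : Reg RapidDecay 2 w) (c : ℝ) (x : Eucl n) (i : Fin n) :
    kconv (fun z => z i ^ 2 * gaussDens n z) c w x =
      kconv (gaussDens n) c w x + c ^ 2 * kconv (gaussDens n) c (pd i (pd i w)) x := by
  have hP := hw.base.polyGrowth.comp_affine x c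
  have hP' := ((hw.pd i).base.polyGrowth.comp_affine x c)
  have h := integral_mul_coord_gaussDens (i := i) (hP.mul (.coord i))
    (h' := fun z => w (x + c • z) + c * (pd i w (x + c • z) * z i))
    (hP.add ((hP'.mul (.coord i)).const_mul c))
    (fun z => by
      have h1 : HasFDerivAt (fun z : Eucl n => z i) (EuclideanSpace.proj i : Eucl n →L[ℝ] ℝ) z :=
        (EuclideanSpace.proj i : Eucl n →L[ℝ] ℝ).hasFDerivAt
      have h2 := (hasLineDerivAt_comp_affine hw.differentiable c x z i).mul
        (h1.hasLineDerivAt (EuclideanSpace.single i 1))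
      refine HasDerivAt.congr_deriv h2 ?_
      simp
      ring)
  have hint := integrable_kconv rapidDecay_gaussDens hw.base.polyGrowth c x
  have hint2 := integrable_kconv ((rapidDecay_gaussDens (n := n)).coord_mul i)
    (hw.pd i).base.polyGrowth c x
  calc _ = ∫ z, w (x + c • z) * z i * z i * gaussDens n z := by
        simp only [kconv]
        congr 1; funext z; ring
    _ = ∫ z,
        (w (x + c • z) * gaussDens n z + c * (pd i w (x + c • z) * (z i * gaussDens n z))) := by
        rw [h]
        congr 1; funext z; ring
    _ = _ := by
        rw [integral_add hint (hint2.const_mul c), integral_const_mul]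
        have := kconv_coord_gaussDens (hw.pd i) c x i
        simp only [kconv] at this ⊢
        rw [this]
        ring

/-- The heat equation. -/
lemma hasDerivAt_gaussConv (hw : Reg RapidDecay 2 w) {s : ℝ} (hs : 0 < s) (x : Eucl n) :
    HasDerivAt (fun s => gaussConv s w x) (1 / 2 * ∑ i, gaussConv s (pd i (pd i w)) x) s := by
  have h := HasDerivAt.comp s (hasDerivAt_kconv rapidDecay_gaussDens hw.pred (√s) x)
    (Real.hasDerivAt_sqrt hs.ne')
  refine h.congr_deriv ?_
  rw [Finset.sum_mul, Finset.mul_sum]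
  refine Finset.sum_congr rfl fun i _ => ?_
  rw [kconv_coord_gaussDens (hw.pd i), gaussConv]
  have := (Real.sqrt_pos.2 hs).ne'
  field_simp

lemma integral_pos_of_pos (hi : Integrable w) (h : ∀ x, 0 < w x) : 0 < ∫ x, w x := by
  rw [integral_pos_iff_support_of_nonneg (fun x => (h x).le) hi,
    Function.support_eq_univ fun x => (h x).ne']
  exact NeZero.pos _

lemma Nice.pos (hw : Nice w) (x : Eucl n) : 0 < w x := by
  obtain ⟨α, c, -, hc, h⟩ := hw.lower
  exact lt_of_lt_of_le (by positivity) (h x)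

lemma Nice.rapid (hw : Nice w) : RapidDecay w := hw.reg 0

lemma Nice.integrable (hw : Nice w) : Integrable w := hw.rapid.integrable

lemma Nice.integral_pos (hw : Nice w) : 0 < ∫ x, w x := integral_pos_of_pos hw.integrable hw.pos

lemma Nice.gaussConv_lower (hw : Nice w) {S : ℝ} (hS : 0 ≤ S) :
    ∃ α c : ℝ, 0 < α ∧ 0 < c ∧ ∀ s x, s ≤ S → c * Real.exp (-α * ‖x‖ ^ 2) ≤ gaussConv s w x := by
  obtain ⟨α, c, hα, hc, h⟩ := hw.lower
  have hP : PolyGrowth (fun z : Eucl n => Real.exp (-(2 * α * S) * ‖z‖ ^ 2)) := by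
    refine .of_bounded (by fun_prop) (C := 1) fun z => ?_
    rw [abs_of_pos (Real.exp_pos _), Real.exp_le_one_iff]
    have := mul_nonneg (by positivity : 0 ≤ 2 * α * S) (sq_nonneg ‖z‖)
    linarith
  have hI := hP.integrable_mul_gaussDens
  refine ⟨2 * α, c * ∫ z, Real.exp (-(2 * α * S) * ‖z‖ ^ 2) * gaussDens n z, by positivity,
    mul_pos hc (integral_pos_of_pos hI fun z => mul_pos (Real.exp_pos _) (gaussDens_pos z)),
    fun s x hs => ?_⟩
  rw [mul_right_comm, ← integral_const_mul]
  refine integral_mono (hI.const_mul _)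
    (integrable_kconv rapidDecay_gaussDens hw.rapid.polyGrowth _ x) fun z => ?_
  simp only
  rw [← mul_assoc]
  refine mul_le_mul_of_nonneg_right (le_trans ?_ (h _)) (gaussDens_pos z).le
  rw [mul_assoc, ← Real.exp_add]
  gcongr
  have h1 : ‖x + √s • z‖ ^ 2 ≤ 2 * ‖x‖ ^ 2 + 2 * S * ‖z‖ ^ 2 := by
    have h2 : ‖√s • z‖ ^ 2 ≤ S * ‖z‖ ^ 2 := by
      rw [norm_smul, mul_pow, Real.norm_eq_abs, sq_abs]
      gcongr
      rcases le_total 0 s with h0 | h0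
      · rwa [Real.sq_sqrt h0]
      · simpa [Real.sqrt_eq_zero_of_nonpos h0] using hS
    have h3 : ‖x + √s • z‖ ^ 2 ≤ (‖x‖ + ‖√s • z‖) ^ 2 := by gcongr; exact norm_add_le _ _
    nlinarith [sq_nonneg (‖x‖ - ‖√s • z‖)]
  nlinarith

lemma Nice.conv (hw : Nice w) (s : ℝ) : Nice (gaussConv s w) := by
  refine ⟨fun k => (hw.reg k).conv s, ?_⟩
  obtain ⟨α, c, hα, hc, h⟩ := hw.gaussConv_lower (abs_nonneg s)
  exact ⟨α, c, hα, hc, fun x => h s x (le_abs_self s)⟩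

lemma Nice.mul (hv : Nice v) (hw : Nice w) : Nice (fun x => v x * w x) := by
  refine ⟨fun k => (hv.reg k).mul_rapid (hw.reg k), ?_⟩
  obtain ⟨α, c, hα, hc, h⟩ := hv.lower
  obtain ⟨β, d, hβ, hd, h'⟩ := hw.lower
  refine ⟨α + β, c * d, by positivity, by positivity, fun x => ?_⟩
  refine le_trans (le_of_eq ?_) (mul_le_mul (h x) (h' x) (by positivity) (hv.pos x).le)
  rw [neg_add, add_mul, Real.exp_add]
  ring

lemma Nice.const_mul (hw : Nice w) {a : ℝ} (ha : 0 < a) : Nice (fun x => a * w x) := by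
  refine ⟨fun k => (hw.reg k).const_mul a, ?_⟩
  obtain ⟨α, c, hα, hc, h⟩ := hw.lower
  refine ⟨α, a * c, hα, by positivity, fun x => ?_⟩
  rw [mul_assoc]
  exact mul_le_mul_of_nonneg_left (h x) ha.le

lemma Nice.abs_log_gaussConv_le (hw : Nice w) {S : ℝ} (hS : 0 ≤ S) :
    ∃ C : ℝ, 0 ≤ C ∧ ∀ s x, s ≤ S → |Real.log (gaussConv s w x)| ≤ C * (1 + ‖x‖ ^ 2) := by
  obtain ⟨α, c, hα, hc, h⟩ := hw.gaussConv_lower hS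
  obtain ⟨B, hB, hb⟩ := gaussConv_bound hw.rapid hS 0
  refine ⟨α + |Real.log c| + |Real.log (B + 1)|, by positivity, fun s x hs => ?_⟩
  have h1 := h s x hs
  have h0 : 0 < gaussConv s w x := (hw.conv s).pos x
  have h2 : gaussConv s w x ≤ B + 1 := by
    have := (le_abs_self _).trans (by simpa using hb s x hs)
    linarith
  have h3 := Real.log_le_log (by positivity) h1
  rw [Real.log_mul hc.ne' (Real.exp_pos _).ne', Real.log_exp] at h3
  have h4 := Real.log_le_log h0 h2
  have h5 := neg_abs_le (Real.log c)
  have h6 := le_abs_self (Real.log (B + 1))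
  have h7 := sq_nonneg ‖x‖
  rw [abs_le]
  constructor <;> nlinarith [abs_nonneg (Real.log c), abs_nonneg (Real.log (B + 1))]

lemma Nice.log (hw : Nice w) : PolyGrowth (fun x => Real.log (w x)) := by
  obtain ⟨C, -, h⟩ := hw.abs_log_gaussConv_le le_rfl
  refine ⟨hw.rapid.1.log fun x => (hw.pos x).ne', 1, C, fun x => ?_⟩
  simpa [gaussConv_zero] using h 0 x le_rfl

end GaussConv

section Fisher

variable {n : ℕ} {φ u w : Eucl n → ℝ}

/-- A positive function satisfies `|∂ᵢw|² ≤ 4 M w` as soon as `M` bounds its first two derivatives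
along a unit segment. -/
lemma sq_pd_le_mul (hw : Reg RapidDecay 2 w) (hpos : ∀ x, 0 < w x) (i : Fin n) (x : Eucl n)
    {M : ℝ} (hM : 0 < M) (h1 : |pd i w x| ≤ M)
    (h2 : ∀ t : ℝ, |t| ≤ 1 → |pd i (pd i w) (x + t • EuclideanSpace.single i 1)| ≤ M) :
    pd i w x ^ 2 ≤ 4 * M * w x := by
  set e : Eucl n := EuclideanSpace.single i 1 with he
  have hline : ∀ {v : Eucl n → ℝ}, Differentiable ℝ v → ∀ t : ℝ,
      HasDerivAt (fun t : ℝ => v (x + t • e)) (pd i v (x + t • e)) t := fun {v} hv t => by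
    have h3 : HasDerivAt (fun t : ℝ => x + t • e) e t := by
      simpa using ((hasDerivAt_id t).smul_const e).const_add x
    exact (hv (x + t • e)).hasFDerivAt.comp_hasDerivAt t h3
  set a := pd i w x with ha
  set h := -a / (2 * M) with hh
  have hle : |h| ≤ 1 := by
    rw [hh, abs_div, abs_neg, abs_of_pos (by positivity : 0 < 2 * M), div_le_one (by positivity)]
    linarith
  have hb1 : ∀ t ∈ Metric.closedBall (0 : ℝ) |h|, |pd i w (x + t • e) - a| ≤ M * |h| := by
    intro t ht
    have ht' : |t| ≤ |h| := by simpa using ht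
    have := (convex_closedBall (0 : ℝ) |h|).norm_image_sub_le_of_norm_hasDerivWithin_le
      (f := fun t : ℝ => pd i w (x + t • e)) (C := M)
      (fun y _ => (hline (hw.pd i).differentiable y).hasDerivWithinAt)
      (fun y hy => h2 y (le_trans (by simpa using hy) hle))
      (Metric.mem_closedBall_self (abs_nonneg h)) ht
    simp only [zero_smul, add_zero, sub_zero, Real.norm_eq_abs] at this
    exact this.trans (by gcongr)
  have hb2 := (convex_closedBall (0 : ℝ) |h|).norm_image_sub_le_of_norm_hasDerivWithin_le
      (f := fun t : ℝ => w (x + t • e) - t * a) (C := M * |h|)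
      (fun y _ => ((hline hw.differentiable y).sub
        ((hasDerivAt_id y).mul_const a)).hasDerivWithinAt)
      (fun y hy => by simpa using hb1 y hy)
      (Metric.mem_closedBall_self (abs_nonneg h)) (y := h) (by simp)
  simp only [zero_smul, add_zero, sub_zero, Real.norm_eq_abs, zero_mul] at hb2
  have h4 := (abs_le.1 hb2).2
  have h5 := hpos (x + h • e)
  have h6 : M * |h| * |h| = a ^ 2 / (4 * M) := by
    rw [mul_assoc, abs_mul_abs_self, hh]
    field_simp
    ring
  have h7 : h * a = -(a ^ 2 / (2 * M)) := by
    rw [hh]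
    field_simp
  rw [h6] at h4
  rw [h7] at h4
  have h8 : a ^ 2 / (2 * M) = 2 * (a ^ 2 / (4 * M)) := by field_simp; ring
  have h9 : a ^ 2 / (4 * M) ≤ w x := by linarith
  rw [div_le_iff₀ (by positivity)] at h9
  linarith

lemma Nice.fisher (hw : Nice w) (i : Fin n) : RapidDecay (fun x => pd i w x ^ 2 / w x) := by
  have hc1 := ((hw.reg 1).pd i).base
  refine ⟨(hc1.1.pow 2).div hw.rapid.1 fun x => (hw.pos x).ne', fun k => ?_⟩
  obtain ⟨C, hC, h1⟩ := hc1.exists_bound k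
  obtain ⟨D, hD, h2⟩ := (((hw.reg 2).pd i).pd i).base.shift_bound 1 k
  refine ⟨4 * (C + D * 2 ^ k + 1), fun x => ?_⟩
  have hp : 0 < (1 + ‖x‖ ^ 2) ^ k := by positivity
  have key := sq_pd_le_mul (hw.reg 2) hw.pos i x
    (M := (C + D * 2 ^ k + 1) / (1 + ‖x‖ ^ 2) ^ k) (by positivity)
    (by
      rw [le_div_iff₀ hp, mul_comm]
      have : 0 ≤ D * 2 ^ k := by positivity
      linarith [h1 x])
    (fun t ht => by
      rw [le_div_iff₀ hp, mul_comm]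
      have h3 := h2 t x (EuclideanSpace.single i 1) (by simpa using ht)
      simp only [PiLp.norm_single, norm_one, one_pow] at h3
      norm_num at h3 ⊢
      linarith)
  rw [abs_of_nonneg (by have := (hw.pos x).le; positivity), ← mul_div_assoc,
    div_le_iff₀ (hw.pos x)]
  calc _ ≤ (1 + ‖x‖ ^ 2) ^ k * (4 * ((C + D * 2 ^ k + 1) / (1 + ‖x‖ ^ 2) ^ k) * w x) := by gcongr
    _ = _ := by field_simp

lemma integral_log_mul_pd (hw : Nice w) (hu : Reg RapidDecay 2 u) (i : Fin n)
    (hint : Integrable fun x => pd i w x / w x * pd i u x) :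
    ∫ x, Real.log (w x) * pd i (pd i u) x = -∫ x, pd i w x / w x * pd i u x :=
  integral_mul_pd_eq_neg (hu.pd i).differentiable
    (fun x => (((hw.reg 1).differentiable x).hasFDerivAt.log (hw.pos x).ne').hasLineDerivAt _
      |>.congr_deriv (by simp [pd]; ring))
    hint (hw.log.mul_rapid ((hu.pd i).pd i).base).integrable
    (hw.log.mul_rapid (hu.pd i).base).integrable

lemma integral_log_mul_pd_self (hw : Nice w) (i : Fin n) :
    ∫ x, Real.log (w x) * pd i (pd i w) x = -∫ x, pd i w x ^ 2 / w x := by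
  have h : (fun x => pd i w x ^ 2 / w x) = fun x => pd i w x / w x * pd i w x := by
    funext x; ring
  have h2 := (hw.fisher i).integrable
  rw [h] at h2 ⊢
  exact integral_log_mul_pd hw (hw.reg 2) i h2

lemma integral_pd_mul_pd {v : Eucl n → ℝ} (hv : Reg RapidDecay 1 v) (hw : Reg RapidDecay 2 w)
    (i : Fin n) : ∫ x, v x * pd i (pd i w) x = -∫ x, pd i v x * pd i w x :=
  integral_mul_pd_eq_neg (hw.pd i).differentiable (fun x => hasLineDerivAt_pd hv.differentiable x i)
    ((hv.pd i).base.mul (hw.pd i).base).integrable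
    (hv.base.mul ((hw.pd i).pd i).base).integrable (hv.base.mul (hw.pd i).base).integrable

lemma hasDerivAt_integral_mul_gaussConv (hφ : PolyGrowth φ) (hw : Reg RapidDecay 2 w) {s : ℝ}
    (hs : 0 < s) :
    HasDerivAt (fun s => ∫ x, φ x * gaussConv s w x)
      (1 / 2 * ∑ i, ∫ x, φ x * gaussConv s (pd i (pd i w)) x) s := by
  obtain ⟨k, C, hC, hφb⟩ := hφ.exists_bound
  choose D hD hb using fun i =>
    gaussConv_bound ((hw.pd i).pd i).base (by positivity : 0 ≤ s + 1) (k + (n + 1))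
  have hint : ∀ i, Integrable fun x => φ x * gaussConv s (pd i (pd i w)) x := fun i =>
    (hφ.mul_rapid (((hw.pd i).pd i).base.conv s)).integrable
  have key := hasDerivAt_integral_of_dominated_loc_of_deriv_le (μ := (volume : Measure (Eucl n)))
    (F := fun s x => φ x * gaussConv s w x) (x₀ := s) (s := Ioo 0 (s + 1)) (𝕜 := ℝ)
    (F' := fun s x => φ x * (1 / 2 * ∑ i, gaussConv s (pd i (pd i w)) x))
    (bound := fun x => C * (1 / 2 * ∑ i, D i) * ((1 + ‖x‖ ^ 2) ^ (n + 1))⁻¹)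
    (Ioo_mem_nhds hs (by linarith))
    (Eventually.of_forall fun s =>
      (hφ.mul_rapid (hw.base.conv s)).1.aestronglyMeasurable)
    (hφ.mul_rapid (hw.base.conv s)).integrable ?_
    (Eventually.of_forall fun x t ht => ?_) (integrable_one_add_normSq_pow_inv.const_mul _)
    (Eventually.of_forall fun x t ht => (hasDerivAt_gaussConv hw ht.1 x).const_mul _)
  · refine key.2.congr_deriv ?_
    rw [← integral_finsetSum _ fun i _ => hint i, ← integral_const_mul]
    congr 1
    funext x
    rw [Finset.mul_sum, Finset.mul_sum, Finset.mul_sum]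
    exact Finset.sum_congr rfl fun i _ => by ring
  · refine (hφ.mul_rapid (RapidDecay.const_mul (1 / 2)
      (RapidDecay.sum _ fun i _ => ?_))).1.aestronglyMeasurable
    exact ((hw.pd i).pd i).base.conv s
  · rw [Real.norm_eq_abs, abs_mul, abs_mul, abs_of_nonneg (by norm_num : (0 : ℝ) ≤ 1 / 2)]
    have h1 : |∑ i, gaussConv t (pd i (pd i w)) x| ≤
        (∑ i, D i) * ((1 + ‖x‖ ^ 2) ^ (k + (n + 1)))⁻¹ := by
      rw [Finset.sum_mul]
      exact (Finset.abs_sum_le_sum_abs _ _).trans (Finset.sum_le_sum fun i _ =>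
        abs_le_mul_inv_of_bound (hb i t x ht.2.le))
    calc _ ≤ (C * (1 + ‖x‖ ^ 2) ^ k) *
          (1 / 2 * ((∑ i, D i) * ((1 + ‖x‖ ^ 2) ^ (k + (n + 1)))⁻¹)) := by
            gcongr; exact hφb x
      _ = _ := by
            rw [pow_add]
            field_simp

lemma Nice.mul_log (hw : Nice w) : RapidDecay (fun x => w x * Real.log (w x)) :=
  hw.rapid.mul_poly hw.log

lemma Nice.gaussConv_mul_log_bound (hw : Nice w) {S : ℝ} (hS : 0 ≤ S) :
    ∃ C : ℝ, ∀ s x, s ≤ S → |gaussConv s w x * Real.log (gaussConv s w x)| ≤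
      C * ((1 + ‖x‖ ^ 2) ^ (n + 1))⁻¹ := by
  obtain ⟨C, hC, h1⟩ := hw.abs_log_gaussConv_le hS
  obtain ⟨D, hD, h2⟩ := gaussConv_bound hw.rapid hS (n + 2)
  refine ⟨D * C, fun s x hs => ?_⟩
  rw [abs_mul]
  calc _ ≤ (D * ((1 + ‖x‖ ^ 2) ^ (n + 2))⁻¹) * (C * (1 + ‖x‖ ^ 2)) := by
        gcongr
        · exact abs_le_mul_inv_of_bound (h2 s x hs)
        · exact h1 s x hs
    _ = _ := by
        rw [pow_succ _ (n + 1)]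
        field_simp

lemma Nice.continuous_entDens (hw : Nice w) :
    Continuous (fun s => entDens n (gaussConv s w)) := by
  refine continuous_iff_continuousAt.2 fun s => ?_
  obtain ⟨C, h⟩ := hw.gaussConv_mul_log_bound (by positivity : 0 ≤ |s| + 1)
  refine continuousAt_of_dominated (bound := fun x => C * ((1 + ‖x‖ ^ 2) ^ (n + 1))⁻¹)
    (Eventually.of_forall fun s => (hw.conv s).mul_log.1.aestronglyMeasurable) ?_
    (integrable_one_add_normSq_pow_inv.const_mul _) (Eventually.of_forall fun x => ?_)
  · filter_upwards [Iio_mem_nhds (by linarith [le_abs_self s] : s < |s| + 1)] with t ht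
    exact Eventually.of_forall fun x => h t x (le_of_lt ht)
  · have hc : Continuous fun s => gaussConv s w x :=
      (continuous_gaussConv hw.rapid).comp (by fun_prop : Continuous fun s : ℝ => (s, x))
    exact (hc.mul (hc.log fun s => ((hw.conv s).pos x).ne')).continuousAt

/-- De Bruijn's identity. -/
lemma Nice.hasDerivAt_entDens (hw : Nice w) {s : ℝ} (hs : 0 < s) :
    HasDerivAt (fun s => entDens n (gaussConv s w))
      (1 / 2 * ∑ i, ∫ x, Real.log (gaussConv s w x) *
        gaussConv s (pd i (pd i w)) x) s := by
  obtain ⟨C, hC, hlog⟩ := hw.abs_log_gaussConv_le (by positivity : 0 ≤ s + 1)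
  have hw2 := hw.reg 2
  choose D hD hb using fun i =>
    gaussConv_bound ((hw2.pd i).pd i).base (by positivity : 0 ≤ s + 1) (n + 2)
  have hr : ∀ i, RapidDecay (gaussConv s (pd i (pd i w))) :=
    fun i => ((hw2.pd i).pd i).base.conv s
  have hint : ∀ i, Integrable fun x => (Real.log (gaussConv s w x) + 1) *
      gaussConv s (pd i (pd i w)) x := fun i =>
    (((hw.conv s).log.add (.const 1)).mul_rapid (hr i)).integrable
  have key := hasDerivAt_integral_of_dominated_loc_of_deriv_le (μ := (volume : Measure (Eucl n)))
    (F := fun s x => gaussConv s w x * Real.log (gaussConv s w x)) (x₀ := s)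
    (s := Ioo 0 (s + 1)) (𝕜 := ℝ)
    (F' := fun s x => (Real.log (gaussConv s w x) + 1) *
      (1 / 2 * ∑ i, gaussConv s (pd i (pd i w)) x))
    (bound := fun x => (C + 1) * (1 / 2 * ∑ i, D i) * ((1 + ‖x‖ ^ 2) ^ (n + 1))⁻¹)
    (Ioo_mem_nhds hs (by linarith))
    (Eventually.of_forall fun s => (hw.conv s).mul_log.1.aestronglyMeasurable)
    (hw.conv s).mul_log.integrable ?_
    (Eventually.of_forall fun x t ht => ?_) (integrable_one_add_normSq_pow_inv.const_mul _)
    (Eventually.of_forall fun x t ht => ?_)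
  · refine key.2.congr_deriv ?_
    calc _ = ∫ x, 1 / 2 * ∑ i, (Real.log (gaussConv s w x) + 1) *
          gaussConv s (pd i (pd i w)) x := by
          congr 1
          funext x
          rw [← Finset.mul_sum]
          ring
      _ = _ := by
          rw [integral_const_mul, integral_finsetSum _ fun i _ => hint i]
          congr 1
          refine Finset.sum_congr rfl fun i _ => ?_
          simp only [add_mul, one_mul]
          rw [integral_add ((hw.conv s).log.mul_rapid (hr i)).integrable (hr i).integrable,
            integral_gaussConv ((hw2.pd i).pd i).base, integral_pd_eq_zero (hw2.pd i), add_zero]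
  · exact (((hw.conv s).log.add (.const 1)).mul_rapid
      (RapidDecay.const_mul (1 / 2) (RapidDecay.sum _ fun i _ => hr i))).1.aestronglyMeasurable
  · rw [Real.norm_eq_abs, abs_mul, abs_mul, abs_of_nonneg (by norm_num : (0 : ℝ) ≤ 1 / 2)]
    have h1 : |∑ i, gaussConv t (pd i (pd i w)) x| ≤
        (∑ i, D i) * ((1 + ‖x‖ ^ 2) ^ (n + 2))⁻¹ := by
      rw [Finset.sum_mul]
      exact (Finset.abs_sum_le_sum_abs _ _).trans (Finset.sum_le_sum fun i _ =>
        abs_le_mul_inv_of_bound (hb i t x ht.2.le))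
    have h2 : |Real.log (gaussConv t w x) + 1| ≤ (C + 1) * (1 + ‖x‖ ^ 2) := by
      refine (abs_add_le _ _).trans ?_
      rw [abs_one]
      nlinarith [hlog t x ht.2.le, sq_nonneg ‖x‖]
    calc _ ≤ ((C + 1) * (1 + ‖x‖ ^ 2)) *
          (1 / 2 * ((∑ i, D i) * ((1 + ‖x‖ ^ 2) ^ (n + 2))⁻¹)) := by gcongr
      _ = _ := by
            rw [pow_succ _ (n + 1)]
            field_simp
  · have h1 := hasDerivAt_gaussConv hw2 ht.1 x
    have h0 := ((hw.conv t).pos x).ne'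
    refine (h1.mul (h1.log h0)).congr_deriv ?_
    field_simp

end Fisher

section LogSobolev

variable {n : ℕ} {w : Eucl n → ℝ}

lemma Nice.sq_pd_gaussConv_div_le (hw : Nice w) {s : ℝ} (hs : 0 < s) {a b : ℝ} (hab : a + b = 1)
    (i : Fin n) (x : Eucl n) :
    gaussConv s (pd i w) x ^ 2 / gaussConv s w x ≤
      a ^ 2 * gaussConv s (fun y => pd i w y ^ 2 / w y) x
        + 2 * a * b * gaussConv s (pd i (pd i w)) x
        + b ^ 2 * (gaussConv s w x / s + gaussConv s (pd i (pd i w)) x) := by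
  set c := √s with hc
  have hc0 : 0 < c := Real.sqrt_pos.2 hs
  have hcs : c ^ 2 = s := Real.sq_sqrt hs.le
  set r := gaussConv s w x with hr
  have hr0 : 0 < r := (hw.conv s).pos x
  set m := gaussConv s (pd i w) x / r with hm
  have hw2 := hw.reg 2
  have hγ := rapidDecay_gaussDens (n := n)
  have hγ2 : RapidDecay (fun z : Eucl n => z i ^ 2 * gaussDens n z) := by
    have := (hγ.coord_mul i).coord_mul i
    refine this.mono (by have := hγ.1; fun_prop) fun z => le_of_eq ?_
    rw [pow_two, mul_assoc]
  have h1 := (integrable_kconv hγ (hw.fisher i).polyGrowth c x).const_mul (a ^ 2)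
  have h2 := (integrable_kconv hγ2 hw.rapid.polyGrowth c x).const_mul (b ^ 2 / c ^ 2)
  have h3 := (integrable_kconv hγ hw.rapid.polyGrowth c x).const_mul (m ^ 2)
  have h4 := (integrable_kconv (hγ.coord_mul i) (hw2.pd i).base.polyGrowth c x).const_mul
    (2 * a * b / c)
  have h5 := (integrable_kconv hγ (hw2.pd i).base.polyGrowth c x).const_mul (2 * a * m)
  have h6 := (integrable_kconv (hγ.coord_mul i) hw.rapid.polyGrowth c x).const_mul (2 * b * m / c)
  have key : 0 ≤ ∫ z, (a ^ 2 * (pd i w (x + c • z) ^ 2 / w (x + c • z) * gaussDens n z)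
      + b ^ 2 / c ^ 2 * (w (x + c • z) * (z i ^ 2 * gaussDens n z))
      + m ^ 2 * (w (x + c • z) * gaussDens n z)
      + 2 * a * b / c * (pd i w (x + c • z) * (z i * gaussDens n z))
      - 2 * a * m * (pd i w (x + c • z) * gaussDens n z)
      - 2 * b * m / c * (w (x + c • z) * (z i * gaussDens n z))) := by
    refine integral_nonneg fun z => ?_
    have hp := hw.pos (x + c • z)
    have hg := gaussDens_pos z
    have : 0 ≤ (a * pd i w (x + c • z) + b * w (x + c • z) * z i / c - m * w (x + c • z)) ^ 2
        / w (x + c • z) * gaussDens n z := by positivity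
    refine this.trans (le_of_eq ?_)
    simp only
    field_simp
    ring
  rw [integral_sub (Integrable.sub' (((h1.fun_add h2).fun_add h3).fun_add h4) h5) h6,
    integral_sub (((h1.fun_add h2).fun_add h3).fun_add h4) h5,
    integral_add ((h1.fun_add h2).fun_add h3) h4, integral_add (h1.fun_add h2) h3,
    integral_add h1 h2] at key
  simp only [integral_const_mul] at key
  have e2 := kconv_coord_sq_gaussDens hw2 c x i
  have e4 := kconv_coord_gaussDens (hw2.pd i) c x i
  have e6 := kconv_coord_gaussDens (hw.reg 1) c x i
  simp only [hc, gaussConv, kconv] at key e2 e4 e6 hr hm ⊢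
  simp only [← hc] at key e2 e4 e6 hr hm ⊢
  rw [e2, e4, e6, ← hr] at key
  have hmr : ∫ z, pd i w (x + c • z) * gaussDens n z = m * r := by
    rw [hm]; field_simp
  rw [hmr] at key ⊢
  set Q := ∫ z, pd i (pd i w) (x + c • z) * gaussDens n z
  set T := ∫ z, pd i w (x + c • z) ^ 2 / w (x + c • z) * gaussDens n z
  rw [← hcs]
  have e : (m * r) ^ 2 / r = m ^ 2 * r := by field_simp
  have e' : a ^ 2 * T + b ^ 2 / c ^ 2 * (r + c ^ 2 * Q) + m ^ 2 * r + 2 * a * b / c * (c * Q)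
      - 2 * a * m * (m * r) - 2 * b * m / c * (c * (m * r)) =
      a ^ 2 * T + 2 * a * b * Q + b ^ 2 * (r / c ^ 2 + Q) + m ^ 2 * r -
        2 * (a + b) * (m ^ 2 * r) := by
    field_simp
    ring
  rw [e', hab] at key
  rw [e]
  linarith

lemma Nice.fisher_gaussConv_le (hw : Nice w) (h1 : ∫ x, w x = 1) {s : ℝ} (hs : 0 < s) {a b : ℝ}
    (hab : a + b = 1) (i : Fin n) :
    ∫ x, pd i (gaussConv s w) x ^ 2 / gaussConv s w x ≤
      a ^ 2 * (∫ x, pd i w x ^ 2 / w x) + b ^ 2 / s := by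
  have hw2 := hw.reg 2
  have hr2 := ((hw2.pd i).pd i).base
  have i1 := ((hw.fisher i).conv s).integrable.const_mul (a ^ 2)
  have i2 := (hr2.conv s).integrable.const_mul (2 * a * b)
  have i3 := ((hw.conv s).integrable.div_const s).fun_add (hr2.conv s).integrable
  have key := integral_mono ((hw.conv s).fisher i).integrable
    ((i1.fun_add i2).fun_add (i3.const_mul (b ^ 2))) (fun x => by
      simpa only [pd_gaussConv (hw.reg 1)] using hw.sq_pd_gaussConv_div_le hs hab i x)
  rw [integral_add (i1.fun_add i2) (i3.const_mul (b ^ 2)), integral_add i1 i2, integral_const_mul,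
    integral_const_mul, integral_const_mul,
    integral_add ((hw.conv s).integrable.div_const s) (hr2.conv s).integrable, integral_div,
    integral_gaussConv hr2, integral_gaussConv (hw.fisher i), integral_gaussConv hw.rapid,
    integral_pd_eq_zero (hw2.pd i), h1] at key
  refine key.trans (le_of_eq ?_)
  ring

lemma Nice.gaussConv_mul_log_le (hw : Nice w) (h1 : ∫ x, w x = 1) {s : ℝ} (hs : 0 < s)
    (x : Eucl n) :
    gaussConv s w x * Real.log (gaussConv s w x) ≤
      -(n / 2 * Real.log (2 * Real.pi * s) + n / 2) * gaussConv s w x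
        - s / 2 * ∑ i, gaussConv s (pd i (pd i w)) x := by
  set c := √s with hc
  have hc0 : 0 < c := Real.sqrt_pos.2 hs
  have hcs : c ^ 2 = s := Real.sq_sqrt hs.le
  set m := gaussConv s w x with hm
  have hm0 : 0 < m := (hw.conv s).pos x
  have hw2 := hw.reg 2
  have hγ := rapidDecay_gaussDens (n := n)
  have hγ2 : ∀ i, RapidDecay (fun z : Eucl n => z i ^ 2 * gaussDens n z) := fun i => by
    have := (hγ.coord_mul i).coord_mul i
    refine this.mono (by have := hγ.1; fun_prop) fun z => le_of_eq ?_
    rw [pow_two, mul_assoc]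
  set K := -(n / 2 * Real.log (2 * Real.pi)) - n * Real.log c - Real.log m with hK
  have h2 := integrable_kconv hγ hw.rapid.polyGrowth c x
  have h3 := fun i => integrable_kconv (hγ2 i) hw.rapid.polyGrowth c x
  have h3s := (integrable_finsetSum Finset.univ fun i _ => h3 i).const_mul (1 / 2)
  have h4 : Integrable (fun z => w (x + c • z)) := by
    have := hw.integrable.comp_add_left x
    exact this.comp_smul hc0.ne'
  have h5 : ∫ z, w (x + c • z) = (c ^ n)⁻¹ := by
    have := Measure.integral_comp_smul (volume : Measure (Eucl n)) (fun z => w (x + z)) c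
    rw [this, integral_add_left_eq_self, h1, finrank_euclideanSpace_fin, smul_eq_mul, mul_one,
      abs_of_pos (by positivity)]
  have key := integral_mono (h2.sub (h4.const_mul (c ^ n * m))) ((h2.const_mul K).sub h3s)
    (fun z => by
      have hp := hw.pos (x + c • z)
      have hg := gaussDens_pos z
      have hcm : 0 < c ^ n * m := by positivity
      have h6 := Real.one_sub_inv_le_log_of_pos (div_pos hg hcm)
      rw [Real.log_div hg.ne' hcm.ne', Real.log_mul (by positivity) hm0.ne', Real.log_pow,
        log_gaussDens, inv_div] at h6
      have h7 := mul_le_mul_of_nonneg_left h6 (mul_pos hp hg).le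
      have h8 : ∑ i, w (x + c • z) * (z i ^ 2 * gaussDens n z) =
          w (x + c • z) * gaussDens n z * ‖z‖ ^ 2 := by
        rw [EuclideanSpace.real_norm_sq_eq, Finset.mul_sum]
        exact Finset.sum_congr rfl fun i _ => by ring
      simp only [Pi.sub_apply]
      rw [h8]
      refine le_trans (le_of_eq ?_) (h7.trans (le_of_eq ?_))
      · field_simp
      · rw [hK]; ring)
  simp only [Pi.sub_apply] at key
  rw [integral_sub h2 (h4.const_mul _), integral_sub (h2.const_mul K) h3s, integral_const_mul,
    integral_const_mul, integral_const_mul, integral_finsetSum _ fun i _ => h3 i, h5] at key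
  have e3 := fun i => kconv_coord_sq_gaussDens hw2 c x i
  simp only [hc, gaussConv, kconv] at key e3 hm ⊢
  simp only [← hc] at key e3 hm ⊢
  simp only [e3, ← hm, Finset.sum_add_distrib, Finset.sum_const, Finset.card_univ, Fintype.card_fin,
    nsmul_eq_mul, ← Finset.mul_sum, hcs] at key
  have e : c ^ n * m * (c ^ n)⁻¹ = m := by field_simp
  have hlog : Real.log (2 * Real.pi * s) = Real.log (2 * Real.pi) + 2 * Real.log c := by
    rw [← hcs, Real.log_mul (by positivity) (by positivity), Real.log_pow]
    norm_num
  rw [e, sub_self] at key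
  rw [hlog]
  rw [hK] at key
  linarith

lemma Nice.entDens_gaussConv_le (hw : Nice w) (h1 : ∫ x, w x = 1) {s : ℝ} (hs : 0 < s) :
    entDens n (gaussConv s w) ≤ -(n / 2 * Real.log (2 * Real.pi * s) + n / 2) := by
  have hr2 : ∀ i, RapidDecay (pd i (pd i w)) := fun i => (((hw.reg 2).pd i).pd i).base
  have i1 := (hw.conv s).integrable.const_mul (-(n / 2 * Real.log (2 * Real.pi * s) + n / 2))
  have i2 := (integrable_finsetSum Finset.univ fun i _ => ((hr2 i).conv s).integrable).const_mul
    (s / 2)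
  have key := integral_mono (hw.conv s).mul_log.integrable (i1.sub i2)
    (fun x => hw.gaussConv_mul_log_le h1 hs x)
  simp only [Pi.sub_apply] at key
  rw [integral_sub i1 i2, integral_const_mul, integral_const_mul,
    integral_finsetSum _ fun i _ => ((hr2 i).conv s).integrable, integral_gaussConv hw.rapid,
    h1] at key
  have h0 : ∀ i, ∫ x, gaussConv s (pd i (pd i w)) x = 0 := fun i => by
    rw [integral_gaussConv (hr2 i), integral_pd_eq_zero ((hw.reg 2).pd i)]
  simpa [h0, entDens] using key

/-- The logarithmic Sobolev inequality for Lebesgue measure, in linearized form. -/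
lemma Nice.log_sobolev (hw : Nice w) (h1 : ∫ x, w x = 1) {r : ℝ} (hr : 0 < r) :
    entDens n w + n / 2 * Real.log (2 * Real.pi * r) + n ≤
      r / 2 * ∑ i, ∫ x, pd i w x ^ 2 / w x := by
  set J := ∑ i, ∫ x, pd i w x ^ 2 / w x with hJ
  have hJ0 : 0 ≤ J := Finset.sum_nonneg fun i _ => integral_nonneg fun x => by
    have := hw.pos x
    positivity
  set K : ℝ → ℝ := fun s => entDens n (gaussConv s w) - 1 / 2 * (J * r ^ 2 / (r + s))
    + n / 2 * (Real.log (r + s) + r / (r + s)) with hKdef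
  have hmono : MonotoneOn K (Ici 0) := by
    have hderiv : ∀ s ∈ interior (Ici (0 : ℝ)), HasDerivAt K
        (1 / 2 * ∑ i, (∫ x, Real.log (gaussConv s w x) * gaussConv s (pd i (pd i w)) x)
          + 1 / 2 * (J * r ^ 2 / (r + s) ^ 2) + n / 2 * (s / (r + s) ^ 2)) s := by
      intro s hs
      rw [interior_Ici] at hs
      have hs : 0 < s := hs
      have hrs : r + s ≠ 0 := by positivity
      have hid : HasDerivAt (fun s => r + s) 1 s := (hasDerivAt_id s).const_add r
      have d1 := ((hasDerivAt_const s (J * r ^ 2)).div hid hrs).const_mul (1 / 2)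
      have d2 := ((hid.log hrs).add ((hasDerivAt_const s r).div hid hrs)).const_mul ((n : ℝ) / 2)
      refine (((hw.hasDerivAt_entDens hs).sub d1).add d2).congr_deriv ?_
      field_simp
      ring
    refine monotoneOn_of_hasDerivWithinAt_nonneg (convex_Ici 0) ?_
      (fun s hs => (hderiv s hs).hasDerivWithinAt) fun s hs => ?_
    · refine ContinuousOn.add (hw.continuous_entDens.continuousOn.sub ?_) ?_
      · refine ContinuousOn.mul continuousOn_const (ContinuousOn.div continuousOn_const
          (by fun_prop) fun s hs => ?_)
        have : (0 : ℝ) ≤ s := hs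
        positivity
      · have h0 : ∀ s ∈ Ici (0 : ℝ), r + s ≠ 0 := fun s hs => by
          have : (0 : ℝ) ≤ s := hs
          positivity
        exact continuousOn_const.mul (((continuousOn_const.add continuousOn_id).log h0).add
          (continuousOn_const.div (continuousOn_const.add continuousOn_id) h0))
    · rw [interior_Ici] at hs
      have hs : 0 < s := hs
      have e : ∀ i, ∫ x, Real.log (gaussConv s w x) * gaussConv s (pd i (pd i w)) x =
          -∫ x, pd i (gaussConv s w) x ^ 2 / gaussConv s w x := fun i => by
        rw [← integral_log_mul_pd_self (hw.conv s), pd_gaussConv (hw.reg 1),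
          pd_gaussConv ((hw.reg 2).pd i)]
      have hb : ∀ i, ∫ x, pd i (gaussConv s w) x ^ 2 / gaussConv s w x ≤
          (r / (r + s)) ^ 2 * (∫ x, pd i w x ^ 2 / w x) + (s / (r + s)) ^ 2 / s := fun i =>
        hw.fisher_gaussConv_le h1 hs (by field_simp) i
      have hsum := Finset.sum_le_sum fun i (_ : i ∈ Finset.univ) => hb i
      rw [Finset.sum_add_distrib, ← Finset.mul_sum, ← hJ, Finset.sum_const, Finset.card_univ,
        Fintype.card_fin, nsmul_eq_mul] at hsum
      simp only [e, Finset.sum_neg_distrib]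
      have e1 : (r / (r + s)) ^ 2 * J = J * r ^ 2 / (r + s) ^ 2 := by rw [div_pow]; ring
      have e2 : (n : ℝ) * ((s / (r + s)) ^ 2 / s) = n * (s / (r + s) ^ 2) := by field_simp
      rw [e1, e2] at hsum
      linarith
  have hbound : ∀ S : ℝ, 0 < S → entDens n w - 1 / 2 * (J * r) + n / 2 * (Real.log r + 1) ≤
      -(n / 2 * Real.log (2 * Real.pi)) - n / 2 + n * (r / S) := by
    intro S hS
    have h2 := hmono (self_mem_Ici) (mem_Ici.2 hS.le) hS.le
    have h3 := hw.entDens_gaussConv_le h1 hS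
    simp only [hKdef, gaussConv_zero, add_zero, div_self hr.ne'] at h2
    have e1 : J * r ^ 2 / r = J * r := by field_simp
    have h4 : 0 ≤ J * r ^ 2 / (r + S) := by positivity
    have h5 : Real.log (r + S) ≤ Real.log S + r / S := by
      have : r + S = S * (1 + r / S) := by field_simp; ring
      rw [this, Real.log_mul hS.ne' (by positivity)]
      have := Real.log_le_sub_one_of_pos (by positivity : 0 < 1 + r / S)
      linarith
    have h6 : r / (r + S) ≤ r / S := by gcongr; linarith
    have h7 : (n : ℝ) / 2 * (Real.log (r + S) + r / (r + S)) ≤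
        n / 2 * (Real.log S + r / S + r / S) := by
      gcongr
    rw [e1] at h2
    rw [Real.log_mul (by positivity) hS.ne'] at h3
    linarith
  have hfin : entDens n w - 1 / 2 * (J * r) + n / 2 * (Real.log r + 1) ≤
      -(n / 2 * Real.log (2 * Real.pi)) - n / 2 := by
    refine le_of_forall_pos_le_add fun ε hε => (hbound ((n + 1) * r / ε) (by positivity)).trans ?_
    have : (n : ℝ) * (r / ((n + 1) * r / ε)) ≤ ε := by
      rw [div_div_eq_mul_div, mul_div_assoc', div_le_iff₀ (by positivity)]
      nlinarith [mul_pos hr hε]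
    linarith
  rw [Real.log_mul (by positivity) hr.ne']
  linarith

end LogSobolev

section LocalInequalities

variable {n : ℕ} {f g w κ : Eucl n → ℝ}

lemma kconv_one (κ w : Eucl n → ℝ) (y : Eucl n) :
    kconv κ 1 w y = ∫ x, w x * κ (x - y) := by
  rw [kconv, ← integral_sub_right_eq_self _ y]
  simp

lemma gaussConv_one (w : Eucl n → ℝ) (y : Eucl n) :
    gaussConv 1 w y = ∫ x, w x * gaussDens n (x - y) := by
  rw [gaussConv, Real.sqrt_one, kconv_one]

lemma integrable_mul_comp_sub (hκ : RapidDecay κ) (hw : PolyGrowth w) (y : Eucl n) :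
    Integrable (fun x => w x * κ (x - y)) := by
  simpa using (integrable_kconv hκ hw 1 y).comp_sub_right y

lemma integral_mul_coord_gaussDens_sub (hw : Reg RapidDecay 1 w) (y : Eucl n) (i : Fin n) :
    ∫ x, w x * ((x i - y i) * gaussDens n (x - y)) = gaussConv 1 (pd i w) y := by
  have h := kconv_coord_gaussDens hw 1 y i
  rw [kconv_one, one_mul] at h
  rw [gaussConv, Real.sqrt_one, ← h]
  rfl

lemma integral_mul_coord_sq_gaussDens_sub (hw : Reg RapidDecay 2 w) (y : Eucl n) (i : Fin n) :
    ∫ x, w x * ((x i - y i) ^ 2 * gaussDens n (x - y)) =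
      gaussConv 1 w y + gaussConv 1 (pd i (pd i w)) y := by
  have h := kconv_coord_sq_gaussDens hw 1 y i
  rw [kconv_one, one_pow, one_mul] at h
  rw [gaussConv, gaussConv, Real.sqrt_one, ← h]
  rfl

lemma rapidDecay_coord_sq_gaussDens (i : Fin n) :
    RapidDecay (fun z : Eucl n => z i ^ 2 * gaussDens n z) :=
  ((PolyGrowth.coord i).mul (PolyGrowth.coord i)).mul_rapid rapidDecay_gaussDens |>.mono
    (by have := (rapidDecay_gaussDens (n := n)).1; fun_prop) fun z => le_of_eq (by rw [pow_two])

lemma Nice.mul_gaussDens_sub (hw : Nice w) (y : Eucl n) :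
    Nice (fun x => w x * gaussDens n (x - y)) := by
  refine ⟨fun k => (hw.reg k).mul_poly (reg_gaussDens_sub y), ?_⟩
  obtain ⟨α, c, hα, hc, h⟩ := hw.lower
  refine ⟨α + 1, c * (Real.exp (-‖y‖ ^ 2) / (2 * Real.pi) ^ ((n : ℝ) / 2)), by positivity,
    by positivity, fun x => ?_⟩
  have h1 : -‖x‖ ^ 2 + -‖y‖ ^ 2 ≤ -‖x - y‖ ^ 2 / 2 := by
    have := parallelogram_law_with_norm ℝ x y
    nlinarith [sq_nonneg ‖x + y‖]
  have h2 : Real.exp (-‖x‖ ^ 2) * (Real.exp (-‖y‖ ^ 2) / (2 * Real.pi) ^ ((n : ℝ) / 2)) ≤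
      gaussDens n (x - y) := by
    rw [gaussDens, ← mul_div_assoc, ← Real.exp_add]
    gcongr
  have h3 : Real.exp (-(α + 1) * ‖x‖ ^ 2) =
      Real.exp (-α * ‖x‖ ^ 2) * Real.exp (-‖x‖ ^ 2) := by
    rw [← Real.exp_add]
    congr 1
    ring
  calc _ = (c * Real.exp (-α * ‖x‖ ^ 2)) *
        (Real.exp (-‖x‖ ^ 2) * (Real.exp (-‖y‖ ^ 2) / (2 * Real.pi) ^ ((n : ℝ) / 2))) := by
        rw [h3]; ring
    _ ≤ _ := mul_le_mul (h x) h2 (by positivity) (hw.pos x).le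

lemma Nice.log_sobolev_of_mass (hw : Nice w) {r : ℝ} (hr : 0 < r) :
    entDens n w - (∫ x, w x) * Real.log (∫ x, w x)
        + (n / 2 * Real.log (2 * Real.pi * r) + n) * (∫ x, w x) ≤
      r / 2 * ∑ i, ∫ x, pd i w x ^ 2 / w x := by
  set I := ∫ x, w x with hI
  have hI0 : 0 < I := hw.integral_pos
  have h := (hw.const_mul (inv_pos.2 hI0)).log_sobolev
    (by rw [integral_const_mul, ← hI, inv_mul_cancel₀ hI0.ne']) hr
  have e1 : ∀ i, ∫ x, pd i (fun x => I⁻¹ * w x) x ^ 2 / (I⁻¹ * w x) =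
      I⁻¹ * ∫ x, pd i w x ^ 2 / w x := fun i => by
    rw [← integral_const_mul]
    congr 1
    funext x
    rw [pd_const_mul (hw.reg 1).differentiable]
    have := (hw.pos x).ne'
    field_simp
  have e2 : entDens n (fun x => I⁻¹ * w x) = I⁻¹ * (entDens n w - I * Real.log I) := by
    have : (fun x => I⁻¹ * w x * Real.log (I⁻¹ * w x)) =
        fun x => I⁻¹ * (w x * Real.log (w x) - Real.log I * w x) := by
      funext x
      rw [Real.log_mul (inv_ne_zero hI0.ne') (hw.pos x).ne', Real.log_inv]
      ring
    rw [entDens, this, integral_const_mul, integral_sub hw.mul_log.integrable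
      (hw.integrable.const_mul _), integral_const_mul, ← hI, entDens, mul_comm I]
  simp only [e1, e2, ← Finset.mul_sum] at h
  have h2 := mul_le_mul_of_nonneg_left h hI0.le
  have e3 : I * (r / 2 * (I⁻¹ * ∑ i, ∫ x, pd i w x ^ 2 / w x)) =
      r / 2 * ∑ i, ∫ x, pd i w x ^ 2 / w x := by field_simp
  have e4 : I * (I⁻¹ * (entDens n w - I * Real.log I) + n / 2 * Real.log (2 * Real.pi * r) + n) =
      entDens n w - I * Real.log I + (n / 2 * Real.log (2 * Real.pi * r) + n) * I := by
    field_simp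
    ring
  rw [e3, e4] at h2
  exact h2

lemma Nice.entDens_mul_gaussDens_sub (hw : Nice w) (y : Eucl n) :
    entDens n (fun x => w x * gaussDens n (x - y)) =
      gaussConv 1 (fun x => w x * Real.log (w x)) y
        - (n / 2 * Real.log (2 * Real.pi)) * gaussConv 1 w y
        - 1 / 2 * (n * gaussConv 1 w y + ∑ i, gaussConv 1 (pd i (pd i w)) y) := by
  have hγ := rapidDecay_gaussDens (n := n)
  have i1 := integrable_mul_comp_sub hγ hw.mul_log.polyGrowth y
  have i2 := (integrable_mul_comp_sub hγ hw.rapid.polyGrowth y).const_mul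
    (n / 2 * Real.log (2 * Real.pi))
  have i3 := fun i => integrable_mul_comp_sub (rapidDecay_coord_sq_gaussDens i)
    hw.rapid.polyGrowth y
  have i4 := (integrable_finsetSum Finset.univ fun i _ => i3 i).const_mul (1 / 2)
  have e : (fun x => w x * gaussDens n (x - y) * Real.log (w x * gaussDens n (x - y))) =
      fun x => w x * Real.log (w x) * gaussDens n (x - y)
        - n / 2 * Real.log (2 * Real.pi) * (w x * gaussDens n (x - y))
        - 1 / 2 * ∑ i, w x * ((x - y) i ^ 2 * gaussDens n (x - y)) := by
    funext x
    have h8 : ∑ i, w x * ((x - y) i ^ 2 * gaussDens n (x - y)) =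
        w x * gaussDens n (x - y) * ‖x - y‖ ^ 2 := by
      rw [EuclideanSpace.real_norm_sq_eq, Finset.mul_sum]
      exact Finset.sum_congr rfl fun i _ => by ring
    rw [Real.log_mul (hw.pos x).ne' (gaussDens_pos _).ne', log_gaussDens, h8]
    ring
  rw [entDens, e, integral_sub (Integrable.sub' i1 i2) i4, integral_sub i1 i2, integral_const_mul,
    integral_const_mul, integral_finsetSum _ fun i _ => i3 i, ← gaussConv_one, ← gaussConv_one]
  congr 2
  have := fun i => integral_mul_coord_sq_gaussDens_sub (hw.reg 2) y i
  simp only [PiLp.sub_apply, this, Finset.sum_add_distrib, Finset.sum_const, Finset.card_univ,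
    Fintype.card_fin, nsmul_eq_mul]

lemma Nice.log_sobolev_local (hw : Nice w) {r : ℝ} (hr : 0 < r) (y : Eucl n) :
    gaussConv 1 (fun x => w x * Real.log (w x)) y - gaussConv 1 w y * Real.log (gaussConv 1 w y)
        - 1 / 2 * ∑ i, gaussConv 1 (pd i (pd i w)) y
        + n / 2 * (Real.log r + 1) * gaussConv 1 w y ≤
      r / 2 * (∑ i, gaussConv 1 (fun x => pd i w x ^ 2 / w x) y
        - ∑ i, gaussConv 1 (pd i (pd i w)) y + n * gaussConv 1 w y) := by
  have hγ := rapidDecay_gaussDens (n := n)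
  have h := (hw.mul_gaussDens_sub y).log_sobolev_of_mass hr
  have hF : ∀ i, ∫ x, pd i (fun x => w x * gaussDens n (x - y)) x ^ 2 /
        (w x * gaussDens n (x - y)) =
      gaussConv 1 (fun x => pd i w x ^ 2 / w x) y - gaussConv 1 (pd i (pd i w)) y
        + gaussConv 1 w y := fun i => by
    have i1 := integrable_mul_comp_sub hγ (hw.fisher i).polyGrowth y
    have i2 := (integrable_mul_comp_sub (hγ.coord_mul i) ((hw.reg 1).pd i).base.polyGrowth
      y).const_mul 2
    have i3 := integrable_mul_comp_sub (rapidDecay_coord_sq_gaussDens i) hw.rapid.polyGrowth y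
    have e : (fun x => pd i (fun x => w x * gaussDens n (x - y)) x ^ 2 /
        (w x * gaussDens n (x - y))) = fun x => pd i w x ^ 2 / w x * gaussDens n (x - y)
          - 2 * (pd i w x * ((x - y) i * gaussDens n (x - y)))
          + w x * ((x - y) i ^ 2 * gaussDens n (x - y)) := by
      funext x
      rw [pd_mul (hw.reg 1).differentiable
        (reg_gaussDens_sub y : Reg PolyGrowth 1 _).differentiable, pd_gaussDens_sub]
      have h1 := (hw.pos x).ne'
      have h2 := (gaussDens_pos (x - y)).ne'
      simp only [PiLp.sub_apply]
      field_simp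
      ring
    rw [e, integral_add (Integrable.sub' i1 i2) i3, integral_sub i1 i2, integral_const_mul,
      ← gaussConv_one]
    simp only [PiLp.sub_apply, integral_mul_coord_sq_gaussDens_sub (hw.reg 2),
      integral_mul_coord_gaussDens_sub ((hw.reg 2).pd i)]
    ring
  rw [hw.entDens_mul_gaussDens_sub, ← gaussConv_one] at h
  simp only [hF, Finset.sum_add_distrib, Finset.sum_sub_distrib, Finset.sum_const,
    Finset.card_univ, Fintype.card_fin, nsmul_eq_mul] at h
  rw [Real.log_mul (by positivity) hr.ne'] at h
  linarith

/-- Gibbs' inequality against a Gaussian with arbitrary centre and scale. -/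
lemma Nice.gibbs (hw : Nice w) {a : ℝ} (ha : 0 < a) (m : Eucl n)
    (hint : Integrable fun x => w x * ‖x - m‖ ^ 2) :
    (∫ x, w x) * (Real.log (∫ x, w x) + n * Real.log a - n / 2 * Real.log (2 * Real.pi))
        - a ^ 2 / 2 * ∫ x, w x * ‖x - m‖ ^ 2 ≤ entDens n w := by
  set I := ∫ x, w x with hI
  have hI0 : 0 < I := hw.integral_pos
  set K := Real.log I + n * Real.log a - n / 2 * Real.log (2 * Real.pi) with hK
  have i1 : Integrable (fun x : Eucl n => gaussDens n (a • (x - m))) :=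
    ((rapidDecay_gaussDens (n := n)).integrable.comp_smul ha.ne').comp_sub_right m
  have e1 : ∫ x, gaussDens n (a • (x - m)) = (a ^ n)⁻¹ := by
    rw [integral_sub_right_eq_self (fun x => gaussDens n (a • x)) m, Measure.integral_comp_smul,
      integral_gaussDens, finrank_euclideanSpace_fin, smul_eq_mul, mul_one,
      abs_of_pos (by positivity)]
  have i2 := (hw.integrable.const_mul K)
  have i3 := hint.const_mul (a ^ 2 / 2)
  have key := integral_mono ((i2.sub i3).add (hw.integrable.sub (i1.const_mul (I * a ^ n))))
    hw.mul_log.integrable (fun x => by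
      have hp := hw.pos x
      have hg := gaussDens_pos (a • (x - m))
      have hd : 0 < I * a ^ n * gaussDens n (a • (x - m)) := by positivity
      have h6 := Real.one_sub_inv_le_log_of_pos (div_pos hp hd)
      rw [Real.log_div hp.ne' hd.ne', Real.log_mul (by positivity) hg.ne',
        Real.log_mul hI0.ne' (by positivity), Real.log_pow, log_gaussDens, inv_div, norm_smul,
        mul_pow, Real.norm_eq_abs, sq_abs] at h6
      have h7 := mul_le_mul_of_nonneg_left h6 hp.le
      have h8 : w x * (1 - I * a ^ n * gaussDens n (a • (x - m)) / w x) =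
          w x - I * a ^ n * gaussDens n (a • (x - m)) := by field_simp
      rw [h8] at h7
      simp only [Pi.sub_apply, Pi.add_apply]
      rw [hK]
      linarith)
  simp only [Pi.sub_apply, Pi.add_apply] at key
  rw [integral_add (Integrable.sub' i2 i3)
      (Integrable.sub' hw.integrable (i1.const_mul (I * a ^ n))), integral_sub i2 i3,
    integral_sub hw.integrable (i1.const_mul (I * a ^ n)), integral_const_mul, integral_const_mul,
    integral_const_mul, e1, ← hI, mul_assoc, mul_inv_cancel₀ (by positivity), mul_one, sub_self,
    add_zero] at key
  rw [mul_comm I]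
  exact key

lemma Nice.gibbs_local (hw : Nice w) {r : ℝ} (hr : 0 < r) (y : Eucl n) :
    -gaussConv 1 (fun x => w x * Real.log (w x)) y + gaussConv 1 w y * Real.log (gaussConv 1 w y)
        + 1 / 2 * ∑ i, gaussConv 1 (pd i (pd i w)) y
        + n / 2 * (1 - Real.log r) * gaussConv 1 w y ≤
      1 / (2 * r) * (n * gaussConv 1 w y + ∑ i, gaussConv 1 (pd i (pd i w)) y
        - ∑ i, pd i (gaussConv 1 w) y ^ 2 / gaussConv 1 w y) := by
  have hγ := rapidDecay_gaussDens (n := n)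
  set G := gaussConv 1 w y with hG
  have hG0 : 0 < G := (hw.conv 1).pos y
  set m : Eucl n := WithLp.toLp 2 fun i => gaussConv 1 (pd i w) y / G with hm
  have i1 := fun i => integrable_mul_comp_sub (rapidDecay_coord_sq_gaussDens i)
    hw.rapid.polyGrowth y
  have i2 := fun i => (integrable_mul_comp_sub (hγ.coord_mul i) hw.rapid.polyGrowth y).const_mul
    (2 * m i)
  have i3 := fun i => (integrable_mul_comp_sub hγ hw.rapid.polyGrowth y).const_mul (m i ^ 2)
  have e : (fun x => w x * gaussDens n (x - y) * ‖x - (y + m)‖ ^ 2) =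
      fun x => ∑ i, (w x * ((x - y) i ^ 2 * gaussDens n (x - y))
        - 2 * m i * (w x * ((x - y) i * gaussDens n (x - y)))
        + m i ^ 2 * (w x * gaussDens n (x - y))) := by
    funext x
    rw [EuclideanSpace.real_norm_sq_eq, Finset.mul_sum]
    refine Finset.sum_congr rfl fun i _ => ?_
    simp only [PiLp.sub_apply, PiLp.add_apply]
    ring
  have i4 := fun i => (Integrable.sub' (i1 i) (i2 i)).fun_add (i3 i)
  have h := (hw.mul_gaussDens_sub y).gibbs (a := (√r)⁻¹) (by positivity) (y + m)
    (by rw [e]; exact integrable_finsetSum _ fun i _ => i4 i)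
  have hs : ∀ i, ∫ x, (w x * ((x - y) i ^ 2 * gaussDens n (x - y))
        - 2 * m i * (w x * ((x - y) i * gaussDens n (x - y)))
        + m i ^ 2 * (w x * gaussDens n (x - y))) =
      G + gaussConv 1 (pd i (pd i w)) y - pd i (gaussConv 1 w) y ^ 2 / G := fun i => by
    rw [integral_add (Integrable.sub' (i1 i) (i2 i)) (i3 i), integral_sub (i1 i) (i2 i),
      integral_const_mul, integral_const_mul, ← gaussConv_one, ← hG]
    simp only [PiLp.sub_apply, integral_mul_coord_sq_gaussDens_sub (hw.reg 2),
      integral_mul_coord_gaussDens_sub (hw.reg 1), ← hG, pd_gaussConv (hw.reg 1), hm]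
    field_simp
    ring
  rw [e, integral_finsetSum _ fun i _ => i4 i, hw.entDens_mul_gaussDens_sub, ← gaussConv_one,
    ← hG] at h
  simp only [hs, Finset.sum_add_distrib, Finset.sum_sub_distrib, Finset.sum_const,
    Finset.card_univ, Fintype.card_fin, nsmul_eq_mul] at h
  rw [Real.log_inv, Real.log_sqrt hr.le, inv_pow, Real.sq_sqrt hr.le] at h
  have e5 : 1 / (2 * r) = r⁻¹ / 2 := by field_simp
  rw [e5]
  linarith

end LocalInequalities

section Dissipation

variable {n : ℕ} {f g h w : Eucl n → ℝ}

lemma integral_mul_lap_comm (hf : Reg RapidDecay 2 f) (hg : Reg RapidDecay 2 g) (i : Fin n) :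
    ∫ x, f x * pd i (pd i g) x = ∫ x, g x * pd i (pd i f) x := by
  rw [integral_pd_mul_pd hf.pred hg, integral_pd_mul_pd hg.pred hf]
  simp only [mul_comm]

lemma Nice.integral_log_mul_pd_mul (hf : Nice f) (hh : Nice h) (i : Fin n) :
    ∫ x, Real.log (f x) * pd i (pd i fun x => f x * h x) x =
      -(∫ x, h x * (pd i f x ^ 2 / f x)) + ∫ x, h x * pd i (pd i f) x := by
  have i1 := (hh.rapid.mul (hf.fisher i)).integrable
  have i2 := (((hh.reg 1).pd i).base.mul ((hf.reg 1).pd i).base).integrable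
  have e : (fun x => pd i f x / f x * pd i (fun x => f x * h x) x) =
      fun x => h x * (pd i f x ^ 2 / f x) + pd i h x * pd i f x := by
    funext x
    rw [pd_mul (hf.reg 1).differentiable (hh.reg 1).differentiable]
    have := (hf.pos x).ne'
    field_simp
  rw [integral_log_mul_pd hf ((hf.mul hh).reg 2) i (by rw [e]; exact i1.add i2), e,
    integral_add i1 i2, integral_pd_mul_pd (hh.reg 1) (hf.reg 2)]
  ring

/-- The pairing `∫ T₁g Δf`. -/
noncomputable def lapPairing (f g : Eucl n → ℝ) : ℝ :=
  ∑ i, ∫ x, gaussConv 1 g x * pd i (pd i f) x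

/-- The quantity `∫ f T₁g log f - ∫ g T₁f log T₁f - (1/2) ∫ T₁g Δf`. -/
noncomputable def entropyGap (f g : Eucl n → ℝ) : ℝ :=
  (∫ x, gaussConv 1 g x * (f x * Real.log (f x)))
    - (∫ x, g x * (gaussConv 1 f x * Real.log (gaussConv 1 f x))) - 1 / 2 * lapPairing f g

/-- The pairing `∫ T₁g |∇f|² / f`. -/
noncomputable def fisherPairing (f h : Eucl n → ℝ) : ℝ :=
  ∑ i, ∫ x, h x * (pd i f x ^ 2 / f x)

lemma integral_gaussConv_mul_pd_pd (hf : Reg RapidDecay 2 f) (hg : RapidDecay g) (i : Fin n) :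
    ∫ x, gaussConv 1 g x * pd i (pd i f) x = ∫ x, g x * pd i (pd i (gaussConv 1 f)) x := by
  rw [← integral_mul_gaussConv hg.polyGrowth ((hf.pd i).pd i).base, pd_gaussConv hf.pred,
    pd_gaussConv (hf.pd i)]

lemma lapPairing_comm (hf : Nice f) (hg : Nice g) : lapPairing f g = lapPairing g f :=
  Finset.sum_congr rfl fun i _ => by
    rw [integral_gaussConv_mul_pd_pd (hf.reg 2) hg.rapid,
      integral_mul_lap_comm (hg.reg 2) ((hf.conv 1).reg 2)]

lemma Nice.integral_log_sobolev (hf : Nice f) (hg : Nice g) (hv : ∫ x, g x * gaussConv 1 f x = 1)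
    {r : ℝ} (hr : 0 < r) :
    entropyGap f g + n / 2 * (Real.log r + 1) ≤
      r / 2 * (fisherPairing f (gaussConv 1 g) - lapPairing f g + n) := by
  have hL := fun i => (((hf.reg 2).pd i).pd i).base
  have i1 := (hg.rapid.mul (hf.mul_log.conv 1)).integrable
  have i2 := (hg.rapid.mul (hf.conv 1).mul_log).integrable
  have i3 := fun i => (hg.rapid.mul ((hL i).conv 1)).integrable
  have i4 := (hg.rapid.mul (hf.conv 1).rapid).integrable
  have i5 := fun i => (hg.rapid.mul ((hf.fisher i).conv 1)).integrable
  have i3s := integrable_finsetSum Finset.univ fun i _ => i3 i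
  have i5s := integrable_finsetSum Finset.univ fun i _ => i5 i
  have key := integral_mono
    (((i1.sub i2).sub (i3s.const_mul (1 / 2))).add (i4.const_mul (n / 2 * (Real.log r + 1))))
    (((i5s.sub i3s).add (i4.const_mul n)).const_mul (r / 2)) (fun y => by
      have := mul_le_mul_of_nonneg_left (hf.log_sobolev_local hr y) (hg.pos y).le
      simp only [Pi.sub_apply, Pi.add_apply, ← Finset.mul_sum]
      linarith)
  simp only [Pi.sub_apply, Pi.add_apply] at key
  rw [integral_add (Integrable.sub' (Integrable.sub' i1 i2) (i3s.const_mul _)) (i4.const_mul _),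
    integral_sub (Integrable.sub' i1 i2) (i3s.const_mul _), integral_sub i1 i2,
    integral_const_mul, integral_const_mul, integral_const_mul,
    integral_add (Integrable.sub' i5s i3s) (i4.const_mul _), integral_sub i5s i3s,
    integral_const_mul, integral_finsetSum _ fun i _ => i3 i, integral_finsetSum _ fun i _ => i5 i,
    hv, mul_one, mul_one, integral_mul_gaussConv hg.rapid.polyGrowth hf.mul_log] at key
  simp only [integral_mul_gaussConv hg.rapid.polyGrowth (hL _),
    integral_mul_gaussConv hg.rapid.polyGrowth (hf.fisher _)] at key
  simp only [entropyGap, fisherPairing, lapPairing]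
  exact key

lemma Nice.integral_gibbs (hf : Nice f) (hg : Nice g) (hu : ∫ x, f x * gaussConv 1 g x = 1)
    {r : ℝ} (hr : 0 < r) :
    -entropyGap g f + n / 2 * (1 - Real.log r) ≤
      1 / (2 * r) * (n + lapPairing f g - fisherPairing (gaussConv 1 g) f) := by
  have hL := fun i => (((hg.reg 2).pd i).pd i).base
  have i1 := (hf.rapid.mul (hg.mul_log.conv 1)).integrable
  have i2 := (hf.rapid.mul (hg.conv 1).mul_log).integrable
  have i3 := fun i => (hf.rapid.mul ((hL i).conv 1)).integrable
  have i4 := (hf.rapid.mul (hg.conv 1).rapid).integrable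
  have i5 := fun i => (hf.rapid.mul ((hg.conv 1).fisher i)).integrable
  have i3s := integrable_finsetSum Finset.univ fun i _ => i3 i
  have i5s := integrable_finsetSum Finset.univ fun i _ => i5 i
  have key := integral_mono
    (((i2.sub i1).add (i3s.const_mul (1 / 2))).add (i4.const_mul (n / 2 * (1 - Real.log r))))
    ((((i4.const_mul n).add i3s).sub i5s).const_mul (1 / (2 * r))) (fun y => by
      have := mul_le_mul_of_nonneg_left (hg.gibbs_local hr y) (hf.pos y).le
      simp only [Pi.sub_apply, Pi.add_apply, ← Finset.mul_sum]
      linarith)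
  simp only [Pi.sub_apply, Pi.add_apply] at key
  rw [integral_add ((Integrable.sub' i2 i1).fun_add (i3s.const_mul _)) (i4.const_mul _),
    integral_add (Integrable.sub' i2 i1) (i3s.const_mul _), integral_sub i2 i1,
    integral_const_mul, integral_const_mul, integral_const_mul,
    integral_sub ((i4.const_mul _).fun_add i3s) i5s, integral_add (i4.const_mul _) i3s,
    integral_const_mul, integral_finsetSum _ fun i _ => i3 i, integral_finsetSum _ fun i _ => i5 i,
    hu, mul_one, mul_one, integral_mul_gaussConv hf.rapid.polyGrowth hg.mul_log] at key
  simp only [integral_mul_gaussConv hf.rapid.polyGrowth (hL _)] at key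
  rw [lapPairing_comm hf hg]
  simp only [entropyGap, fisherPairing, lapPairing]
  linarith

lemma Nice.le_fisherPairing (hn : 1 ≤ n) (hf : Nice f) (hg : Nice g)
    (hv : ∫ x, g x * gaussConv 1 f x = 1) :
    n * Real.exp (2 * entropyGap f g / n) ≤
      fisherPairing f (gaussConv 1 g) - lapPairing f g + n := by
  have hn0 : (0 : ℝ) < n := by exact_mod_cast hn
  have h := hf.integral_log_sobolev hg hv (Real.exp_pos (-(2 * entropyGap f g / n)))
  rw [Real.log_exp, Real.exp_neg] at h
  have e : entropyGap f g + n / 2 * (-(2 * entropyGap f g / n) + 1) = n / 2 := by field_simp; ring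
  rw [e] at h
  have := mul_le_mul_of_nonneg_left h
    (by positivity : 0 ≤ 2 * Real.exp (2 * entropyGap f g / n))
  field_simp at this
  linarith

lemma Nice.le_sub_fisherPairing (hn : 1 ≤ n) (hf : Nice f) (hg : Nice g)
    (hu : ∫ x, f x * gaussConv 1 g x = 1) :
    n * Real.exp (-(2 * entropyGap g f / n)) ≤
      n + lapPairing f g - fisherPairing (gaussConv 1 g) f := by
  have hn0 : (0 : ℝ) < n := by exact_mod_cast hn
  have h := hf.integral_gibbs hg hu (Real.exp_pos (-(2 * entropyGap g f / n)))
  rw [Real.log_exp] at h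
  have e : -entropyGap g f + n / 2 * (1 - -(2 * entropyGap g f / n)) = n / 2 := by field_simp; ring
  rw [e] at h
  have := mul_le_mul_of_nonneg_left h
    (by positivity : 0 ≤ 2 * Real.exp (-(2 * entropyGap g f / n)))
  field_simp at this ⊢
  linarith

lemma Nice.entDens_mul (hf : Nice f) (hh : Nice h) :
    entDens n (fun x => f x * h x) =
      (∫ x, h x * (f x * Real.log (f x))) + ∫ x, f x * (h x * Real.log (h x)) := by
  rw [entDens, ← integral_add (hh.rapid.mul hf.mul_log).integrable
    (hf.rapid.mul hh.mul_log).integrable]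
  congr 1
  funext x
  rw [Real.log_mul (hf.pos x).ne' (hh.pos x).ne']
  ring

lemma entropyGap_sub (hf : Nice f) (hg : Nice g) :
    entropyGap f g - entropyGap g f =
      entDens n (fun x => f x * gaussConv 1 g x) - entDens n (fun x => g x * gaussConv 1 f x) := by
  rw [hf.entDens_mul (hg.conv 1), hg.entDens_mul (hf.conv 1), entropyGap, entropyGap,
    lapPairing_comm hf hg]
  ring

lemma two_add_sinh_le (a b : ℝ) :
    4 + 8 * Real.sinh ((a - b) / 4) ^ 2 ≤
      Real.exp a + Real.exp (-a) + (Real.exp b + Real.exp (-b)) := by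
  have h1 : Real.exp a + Real.exp (-a) + (Real.exp b + Real.exp (-b)) =
      4 * Real.cosh ((a + b) / 2) * Real.cosh ((a - b) / 2) := by
    have ha := Real.cosh_add ((a + b) / 2) ((a - b) / 2)
    have hb := Real.cosh_sub ((a + b) / 2) ((a - b) / 2)
    rw [show (a + b) / 2 + (a - b) / 2 = a by ring] at ha
    rw [show (a + b) / 2 - (a - b) / 2 = b by ring] at hb
    have e1 : Real.exp a + Real.exp (-a) = 2 * Real.cosh a := by rw [Real.cosh_eq]; ring
    have e2 : Real.exp b + Real.exp (-b) = 2 * Real.cosh b := by rw [Real.cosh_eq]; ring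
    rw [e1, e2, ha, hb]
    ring
  have h2 : Real.cosh ((a - b) / 2) = 1 + 2 * Real.sinh ((a - b) / 4) ^ 2 := by
    have : (a - b) / 2 = 2 * ((a - b) / 4) := by ring
    rw [this, Real.cosh_two_mul, Real.cosh_sq]
    ring
  rw [h1]
  nlinarith [Real.one_le_cosh ((a + b) / 2), Real.one_le_cosh ((a - b) / 2)]

lemma Nice.sum_integral_log_mul_pd_mul (hf : Nice f) (hg : Nice g) :
    (1 / 2 * ∑ i, ∫ x, Real.log (f x) * pd i (pd i fun x => f x * gaussConv 1 g x) x)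
      - 1 / 4 * ∑ i, ∫ x, Real.log (f x * gaussConv 1 g x) *
          pd i (pd i fun x => f x * gaussConv 1 g x) x =
      1 / 4 * (fisherPairing (gaussConv 1 g) f - fisherPairing f (gaussConv 1 g)) := by
  have hG := hg.conv 1
  have hu2 := fun i => ((((hf.mul hG).reg 2).pd i).pd i).base
  have e1 : ∀ i, ∫ x, Real.log (f x * gaussConv 1 g x) *
        pd i (pd i fun x => f x * gaussConv 1 g x) x =
      (∫ x, Real.log (f x) * pd i (pd i fun x => f x * gaussConv 1 g x) x)
        + ∫ x, Real.log (gaussConv 1 g x) * pd i (pd i fun x => f x * gaussConv 1 g x) x :=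
    fun i => by
      rw [← integral_add (hf.log.mul_rapid (hu2 i)).integrable
        (hG.log.mul_rapid (hu2 i)).integrable]
      congr 1
      funext x
      rw [Real.log_mul (hf.pos x).ne' (hG.pos x).ne', add_mul]
  have e2 := fun i => hf.integral_log_mul_pd_mul hG i
  have e3 : ∀ i, ∫ x, Real.log (gaussConv 1 g x) *
        pd i (pd i fun x => f x * gaussConv 1 g x) x =
      -(∫ x, f x * (pd i (gaussConv 1 g) x ^ 2 / gaussConv 1 g x))
        + ∫ x, gaussConv 1 g x * pd i (pd i f) x := fun i => by
    have := hG.integral_log_mul_pd_mul hf i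
    rw [integral_mul_lap_comm (hf.reg 2) (hG.reg 2)] at this
    rw [← this]
    simp only [mul_comm]
  simp only [e1, e2, e3, Finset.sum_add_distrib, Finset.sum_neg_distrib, fisherPairing]
  ring

/-- The dissipation of the entropic cost along the heat flow. -/
lemma Nice.dissipation_le (hn : 1 ≤ n) (hf : Nice f) (hg : Nice g)
    (hu : ∫ x, f x * gaussConv 1 g x = 1) (hv : ∫ x, g x * gaussConv 1 f x = 1) :
    (1 / 2 * ∑ i, ∫ x, Real.log (f x) * pd i (pd i fun x => f x * gaussConv 1 g x) x)
      - (1 / 4 * ∑ i, ∫ x, Real.log (f x * gaussConv 1 g x) *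
          pd i (pd i fun x => f x * gaussConv 1 g x) x)
      + ((1 / 2 * ∑ i, ∫ x, Real.log (g x) * pd i (pd i fun x => g x * gaussConv 1 f x) x)
      - (1 / 4 * ∑ i, ∫ x, Real.log (g x * gaussConv 1 f x) *
          pd i (pd i fun x => g x * gaussConv 1 f x) x)) ≤
      -(n * Real.sinh ((entDens n (fun x => f x * gaussConv 1 g x)
        - entDens n (fun x => g x * gaussConv 1 f x)) / (2 * n)) ^ 2) := by
  have hn0 : (0 : ℝ) < n := by exact_mod_cast hn
  rw [hf.sum_integral_log_mul_pd_mul hg, hg.sum_integral_log_mul_pd_mul hf, ← entropyGap_sub hf hg]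
  have h1 := hf.le_fisherPairing hn hg hv
  have h2 := hf.le_sub_fisherPairing hn hg hu
  have h3 := hg.le_fisherPairing hn hf hu
  have h4 := hg.le_sub_fisherPairing hn hf hv
  have h5 := two_add_sinh_le (2 * entropyGap f g / n) (2 * entropyGap g f / n)
  have e : (2 * entropyGap f g / n - 2 * entropyGap g f / n) / 4 =
      (entropyGap f g - entropyGap g f) / (2 * n) := by field_simp; ring
  rw [e] at h5
  have h6 := mul_le_mul_of_nonneg_left h5 hn0.le
  have h7 : 0 ≤ (n : ℝ) * Real.sinh ((entropyGap f g - entropyGap g f) / (2 * n)) ^ 2 := by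
    positivity
  linarith

end Dissipation

section Semigroup

variable {n : ℕ} {w κ : Eucl n → ℝ}

lemma kconv_eq_rescaled {c : ℝ} (hc : 0 < c) (κ w : Eucl n → ℝ) (x : Eucl n) :
    kconv κ c w x = (c ^ n)⁻¹ * ∫ y, w (x + y) * κ (c⁻¹ • y) := by
  have h := Measure.integral_comp_smul (volume : Measure (Eucl n))
    (fun y => w (x + y) * κ (c⁻¹ • y)) c
  simp only [smul_smul, inv_mul_cancel₀ hc.ne', one_smul] at h
  rw [kconv, h, finrank_euclideanSpace_fin, smul_eq_mul, abs_of_pos (by positivity)]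

lemma gaussDens_mul_gaussDens {a b c : ℝ} (hb : 0 < b) (hc : 0 < c) (h : c ^ 2 = a ^ 2 + b ^ 2)
    (y z : Eucl n) :
    gaussDens n (b⁻¹ • (y - a • z)) * gaussDens n z =
      gaussDens n ((b / c)⁻¹ • (z - (a / c ^ 2) • y)) * gaussDens n (c⁻¹ • y) := by
  simp only [gaussDens]
  rw [div_mul_div_comm, div_mul_div_comm, ← Real.exp_add, ← Real.exp_add]
  congr 2
  simp only [norm_smul, mul_pow, Real.norm_eq_abs, sq_abs, norm_sub_sq_real, inner_smul_right,
    real_inner_comm y z]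
  have hb' : b ^ 2 = c ^ 2 - a ^ 2 := by linarith
  field_simp
  rw [h]
  ring

lemma integral_gaussDens_mul_gaussDens {a b c : ℝ} (hb : 0 < b) (hc : 0 < c)
    (h : c ^ 2 = a ^ 2 + b ^ 2) (y : Eucl n) :
    ∫ z, gaussDens n (b⁻¹ • (y - a • z)) * gaussDens n z =
      (b / c) ^ n * gaussDens n (c⁻¹ • y) := by
  simp only [gaussDens_mul_gaussDens hb hc h, integral_mul_const]
  rw [integral_sub_right_eq_self (fun z => gaussDens n ((b / c)⁻¹ • z)),
    Measure.integral_comp_inv_smul, integral_gaussDens, finrank_euclideanSpace_fin, smul_eq_mul,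
    mul_one, abs_of_pos (by positivity)]

lemma gaussConv_gaussConv (hw : RapidDecay w) {a b : ℝ} (ha : 0 ≤ a) (hb : 0 ≤ b) :
    gaussConv a (gaussConv b w) = gaussConv (a + b) w := by
  rcases hb.eq_or_lt with rfl | hb
  · rw [gaussConv_zero, add_zero]
  funext x
  have hb' : 0 < √b := Real.sqrt_pos.2 hb
  have hc' : 0 < √(a + b) := Real.sqrt_pos.2 (by positivity)
  have hsq : √(a + b) ^ 2 = √a ^ 2 + √b ^ 2 := by
    rw [Real.sq_sqrt (by positivity), Real.sq_sqrt ha, Real.sq_sqrt hb.le]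
  obtain ⟨C, hC, hγb⟩ := (rapidDecay_gaussDens (n := n)).bounded
  have hint : Integrable (fun q : Eucl n × Eucl n => w (x + q.2) *
      (gaussDens n ((√b)⁻¹ • (q.2 - √a • q.1)) * gaussDens n q.1)) (volume.prod volume) := by
    have hdom := ((rapidDecay_gaussDens (n := n)).integrable.mul_prod
      (hw.abs.integrable.comp_add_left x)).const_mul C
    refine hdom.mono' ?_ (Eventually.of_forall fun q => ?_)
    · have h1 := hw.1
      have h2 := (rapidDecay_gaussDens (n := n)).1
      exact (by fun_prop : Continuous fun q : Eucl n × Eucl n => w (x + q.2) *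
        (gaussDens n ((√b)⁻¹ • (q.2 - √a • q.1)) * gaussDens n q.1)).aestronglyMeasurable
    · rw [Real.norm_eq_abs, abs_mul, abs_mul, abs_of_pos (gaussDens_pos q.1)]
      have := (gaussDens_pos q.1).le
      calc _ ≤ |w (x + q.2)| * (C * gaussDens n q.1) := by gcongr; exact hγb _
        _ = _ := by ring
  have hinner : ∀ z, gaussConv b w (x + √a • z) = (√b ^ n)⁻¹ *
      ∫ y, w (x + y) * gaussDens n ((√b)⁻¹ • (y - √a • z)) := fun z => by
    rw [gaussConv, kconv_eq_rescaled hb',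
      ← integral_sub_right_eq_self (fun y => w (x + √a • z + y) * _) (√a • z)]
    simp only [add_assoc, add_sub_cancel]
  calc gaussConv a (gaussConv b w) x
      = ∫ z, (√b ^ n)⁻¹ * ∫ y, w (x + y) *
          (gaussDens n ((√b)⁻¹ • (y - √a • z)) * gaussDens n z) := by
        rw [gaussConv, kconv]
        simp only [hinner, ← mul_assoc, integral_mul_const]
    _ = (√b ^ n)⁻¹ * ∫ y, ∫ z, w (x + y) *
          (gaussDens n ((√b)⁻¹ • (y - √a • z)) * gaussDens n z) := by
        rw [integral_const_mul, integral_integral_swap hint]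
    _ = gaussConv (a + b) w x := by
        simp only [integral_const_mul, integral_gaussDens_mul_gaussDens hb' hc' hsq]
        rw [gaussConv, kconv_eq_rescaled hc', ← integral_const_mul, ← integral_const_mul]
        congr 1
        funext y
        rw [div_pow]
        field_simp

lemma integral_gaussConv_mul_eq {p : Eucl n → ℝ} (hp : PolyGrowth p) (hw : RapidDecay w) (s : ℝ) :
    Integrable (fun z => (∫ x, p (x + √s • z) * w x) * gaussDens n z) ∧
    ∫ x, gaussConv s p x * w x = ∫ z, (∫ x, p (x + √s • z) * w x) * gaussDens n z := by
  have hint := integrable_shift_mul (rapidDecay_gaussDens (n := n)) hp hw (√s)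
  have e : (fun z => ∫ x, p (x + √s • z) * gaussDens n z * w x) =
      fun z => (∫ x, p (x + √s • z) * w x) * gaussDens n z := by
    funext z
    rw [← integral_mul_const]
    congr 1
    funext x
    ring
  refine ⟨by simpa only [← e] using hint.integral_prod_right, ?_⟩
  rw [← e, ← integral_integral_swap hint]
  simp only [gaussConv, kconv, integral_mul_const]

end Semigroup

section RealAnalysis

/-- A function that is right upper semicontinuous and has nonpositive left upper derivatives does
not increase. -/
lemma le_of_left_dini_nonpos {B : ℝ → ℝ} {τ : ℝ} (hτ : 0 ≤ τ)
    (hleft : ∀ t, 0 < t → ∀ ε, 0 < ε → ∀ᶠ s in nhdsWithin t (Iio t), B t - B s ≤ ε * (t - s))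
    (hright : ∀ s, 0 ≤ s → ∀ ε, 0 < ε → ∀ᶠ t in nhdsWithin s (Ioi s), B t ≤ B s + ε) :
    B τ ≤ B 0 := by
  have key : ∀ ε, 0 < ε → B τ < B 0 + ε * (1 + τ) := by
    intro ε hε
    by_contra! hbad
    set S := {t | 0 ≤ t ∧ B 0 + ε * (1 + t) ≤ B t} with hS
    have hSne : S.Nonempty := ⟨τ, hτ, hbad⟩
    have hSbdd : BddBelow S := ⟨0, fun t ht => ht.1⟩
    set c := sInf S with hc
    have hc0 : 0 ≤ c := le_csInf hSne fun t ht => ht.1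
    have hlt : ∀ s, 0 ≤ s → s < c → B s < B 0 + ε * (1 + s) := fun s hs hsc => by
      by_contra! h
      exact absurd (csInf_le hSbdd (⟨hs, h⟩ : s ∈ S)) (not_le.2 hsc)
    have hcB : B c < B 0 + ε * (1 + c) := by
      rcases hc0.eq_or_lt with h0 | h0
      · rw [← h0]
        linarith
      · obtain ⟨s, ⟨hs1, hs2⟩, hs3⟩ :=
          (((hleft c h0 (ε / 2) (by positivity)).and (Ioo_mem_nhdsLT h0)).and
            self_mem_nhdsWithin).exists
        have := hlt s hs2.1.le hs3
        have hs3 : s < c := hs3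
        nlinarith
    have hev := hright c hc0 ((B 0 + ε * (1 + c) - B c) / 2) (by linarith)
    obtain ⟨d, hd, hsub⟩ := mem_nhdsGT_iff_exists_Ioo_subset.1 hev
    have hd : c < d := hd
    have hle : d ≤ c := le_csInf hSne fun t ht => by
      by_contra! htd
      have hct : c ≤ t := csInf_le hSbdd ht
      rcases hct.eq_or_lt with rfl | hct
      · exact absurd ht.2 (not_le.2 hcB)
      · have h1 : B t ≤ B c + _ := hsub ⟨hct, htd⟩
        have h2 := ht.2
        nlinarith
    linarith
  refine le_of_forall_pos_lt_add fun ε hε => ?_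
  have := key (ε / (1 + τ)) (by positivity)
  rwa [div_mul_cancel₀ _ (by positivity)] at this

end RealAnalysis

/-- The pairing `∫ u log f + ∫ v log g` of two potentials with two densities. -/
noncomputable def potentialCost {n : ℕ} (f g u v : Eucl n → ℝ) : ℝ :=
  (∫ x, Real.log (f x) * u x) + ∫ x, Real.log (g x) * v x

section Flow

variable {n : ℕ} {f g F G w U V : Eucl n → ℝ}

lemma RapidDecay.comp_add (hw : RapidDecay w) (a : Eucl n) : RapidDecay (fun x => w (x + a)) := by
  refine ⟨hw.1.comp (by fun_prop), fun k => ?_⟩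
  obtain ⟨C, -, h⟩ := hw.shift_bound 1 k
  exact ⟨C * (1 + ‖a‖ ^ 2) ^ k, fun x => by simpa using h 1 x a (by norm_num)⟩

lemma PolyGrowth.comp_add (hw : PolyGrowth w) (a : Eucl n) : PolyGrowth (fun x => w (x + a)) := by
  simpa [add_comm] using hw.comp_affine a 1

lemma integrable_gaussConv_integrand (hw : PolyGrowth w) (s : ℝ) (x : Eucl n) :
    Integrable (fun z => w (x + √s • z) * gaussDens n z) :=
  integrable_kconv rapidDecay_gaussDens hw _ x

lemma mul_log_sub_le {a b c d : ℝ} (ha : 0 < a) (hb : 0 < b) (hc : 0 < c) (hd : 0 < d) :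
    a * b * (Real.log c - Real.log a + (Real.log d - Real.log b)) ≤ c * d - a * b := by
  have h := Real.log_le_sub_one_of_pos (show 0 < c * d / (a * b) by positivity)
  rw [Real.log_div (by positivity) (by positivity), Real.log_mul hc.ne' hd.ne',
    Real.log_mul ha.ne' hb.ne'] at h
  calc _ ≤ a * b * (c * d / (a * b) - 1) := by
        gcongr
        linarith
    _ = _ := by field_simp

/-- The pair `(f, g)` maximises the dual functional associated with its own marginals. -/
lemma Nice.potentialCost_le (hf : Nice f) (hg : Nice g) (hF : RapidDecay F) (hG : RapidDecay G)
    (hF0 : ∀ x, 0 < F x) (hG0 : ∀ x, 0 < G x) (hlF : PolyGrowth fun x => Real.log (F x))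
    (hlG : PolyGrowth fun x => Real.log (G x))
    (hle : ∫ x, F x * gaussConv 1 G x ≤ ∫ x, f x * gaussConv 1 g x) :
    potentialCost F G (fun x => f x * gaussConv 1 g x) (fun x => g x * gaussConv 1 f x) ≤
      potentialCost f g (fun x => f x * gaussConv 1 g x) (fun x => g x * gaussConv 1 f x) := by
  have hφ := hlF.sub hf.log
  have hψ := hlG.sub hg.log
  have hgψ := hψ.mul_rapid hg.rapid
  have hu := hf.rapid.mul (hg.rapid.conv 1)
  have hv := hg.rapid.mul (hf.rapid.conv 1)
  have hpt : ∀ x, (Real.log (F x) - Real.log (f x)) * (f x * gaussConv 1 g x) +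
      f x * gaussConv 1 (fun y => (Real.log (G y) - Real.log (g y)) * g y) x ≤
      F x * gaussConv 1 G x - f x * gaussConv 1 g x := fun x => by
    have i1 := integrable_gaussConv_integrand hg.rapid.polyGrowth 1 x
    have i2 := integrable_gaussConv_integrand hgψ.polyGrowth 1 x
    have i3 := integrable_gaussConv_integrand hG.polyGrowth 1 x
    have key := integral_mono (((i1.const_mul
      ((Real.log (F x) - Real.log (f x)) * f x)).add (i2.const_mul (f x))))
      ((i3.const_mul (F x)).sub (i1.const_mul (f x))) (fun z => by
        have h := mul_log_sub_le (hf.pos x) (hg.pos (x + √1 • z)) (hF0 x) (hG0 (x + √1 • z))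
        have h' := mul_le_mul_of_nonneg_right h (gaussDens_pos z).le
        simp only [Pi.add_apply, Pi.sub_apply]
        linarith)
    simp only [Pi.add_apply, Pi.sub_apply] at key
    rw [integral_add (i1.const_mul _) (i2.const_mul _),
      integral_sub (i3.const_mul _) (i1.const_mul _)] at key
    simp only [integral_const_mul] at key
    simp only [gaussConv, kconv]
    linarith
  have j1 := (hφ.mul_rapid hu).integrable
  have j2 := (hf.rapid.mul (hgψ.conv 1)).integrable
  have key := integral_mono (j1.add j2)
    ((hF.mul (hG.conv 1)).integrable.sub hu.integrable) hpt
  simp only [Pi.add_apply, Pi.sub_apply] at key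
  rw [integral_add j1 j2, integral_sub (hF.mul (hG.conv 1)).integrable hu.integrable,
    integral_mul_gaussConv hf.rapid.polyGrowth hgψ] at key
  have e1 : ∫ x, (Real.log (F x) - Real.log (f x)) * (f x * gaussConv 1 g x) =
      (∫ x, Real.log (F x) * (f x * gaussConv 1 g x)) -
        ∫ x, Real.log (f x) * (f x * gaussConv 1 g x) := by
    simp only [sub_mul]
    exact integral_sub (hlF.mul_rapid hu).integrable (hf.log.mul_rapid hu).integrable
  have e2 : ∫ x, gaussConv 1 f x * ((Real.log (G x) - Real.log (g x)) * g x) =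
      (∫ x, Real.log (G x) * (g x * gaussConv 1 f x)) -
        ∫ x, Real.log (g x) * (g x * gaussConv 1 f x) := by
    rw [← integral_sub (hlG.mul_rapid hv).integrable (hg.log.mul_rapid hv).integrable]
    congr 1
    funext x
    ring
  simp only [potentialCost]
  linarith

/-- The pairing of potentials does not increase along the heat flow. -/
lemma Nice.potentialCost_gaussConv_le (hf : Nice f) (hg : Nice g) (hF : Nice F) (hG : Nice G)
    {h : ℝ}
    (hU : gaussConv h (fun x => f x * gaussConv 1 g x) = fun x => F x * gaussConv 1 G x)
    (hV : gaussConv h (fun x => g x * gaussConv 1 f x) = fun x => G x * gaussConv 1 F x) :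
    potentialCost F G (fun x => F x * gaussConv 1 G x) (fun x => G x * gaussConv 1 F x) ≤
      potentialCost f g (fun x => f x * gaussConv 1 g x) (fun x => g x * gaussConv 1 f x) := by
  have hu := hf.rapid.mul (hg.rapid.conv 1)
  have hv := hg.rapid.mul (hf.rapid.conv 1)
  have hmass : ∫ x, F x * gaussConv 1 G x = ∫ x, f x * gaussConv 1 g x := by
    rw [← integral_gaussConv hu h, hU]
  have hshift : ∀ a, potentialCost (fun x => F (x + a)) (fun x => G (x + a))
      (fun x => f x * gaussConv 1 g x) (fun x => g x * gaussConv 1 f x) ≤ potentialCost f g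
        (fun x => f x * gaussConv 1 g x) (fun x => g x * gaussConv 1 f x) := fun a => by
    refine hf.potentialCost_le hg (hF.rapid.comp_add a) (hG.rapid.comp_add a)
      (fun x => hF.pos _) (fun x => hG.pos _) (hF.log.comp_add a) (hG.log.comp_add a) ?_
    rw [← hmass, ← integral_add_right_eq_self (fun x => F x * gaussConv 1 G x) a]
    simp only [gaussConv, kconv, add_right_comm, le_refl]
  obtain ⟨i1, e1⟩ := integral_gaussConv_mul_eq hF.log hu h
  obtain ⟨i2, e2⟩ := integral_gaussConv_mul_eq hG.log hv h
  rw [← integral_mul_gaussConv hF.log hu, hU] at e1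
  rw [← integral_mul_gaussConv hG.log hv, hV] at e2
  have key := integral_mono (i1.add i2) (rapidDecay_gaussDens.integrable.const_mul
    (potentialCost f g (fun x => f x * gaussConv 1 g x) (fun x => g x * gaussConv 1 f x)))
    (fun z => by
      have := mul_le_mul_of_nonneg_right (hshift (√h • z)) (gaussDens_pos z).le
      simp only [Pi.add_apply, ← add_mul]
      exact this)
  simp only [Pi.add_apply] at key
  rw [integral_add i1 i2, integral_const_mul, integral_gaussDens, mul_one, ← e1, ← e2] at key
  exact key

lemma pd_pd_gaussConv (hw : Reg RapidDecay 2 w) (s : ℝ) (i : Fin n) :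
    pd i (pd i (gaussConv s w)) = gaussConv s (pd i (pd i w)) := by
  rw [pd_gaussConv hw.pred, pd_gaussConv (hw.pd i)]

lemma HasDerivAt.eventually_left_sub_le {Ψ : ℝ → ℝ} {d t : ℝ} (h : HasDerivAt Ψ d t) (hd : d ≤ 0)
    {ε : ℝ} (hε : 0 < ε) :
    ∀ᶠ s in nhdsWithin t (Iio t), Ψ t - Ψ s ≤ ε * (t - s) := by
  have := (hasDerivAt_iff_isLittleO.1 h).def hε
  filter_upwards [nhdsWithin_le_nhds this, self_mem_nhdsWithin] with s hs hst
  have hst : s < t := hst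
  rw [Real.norm_eq_abs, Real.norm_eq_abs, abs_of_neg (by linarith : s - t < 0), smul_eq_mul] at hs
  have := neg_le_of_abs_le hs
  nlinarith

/-- Contraction of the cost of a flow of Schrödinger decompositions. -/
theorem potentialCost_flow_le (hn : 1 ≤ n) (hU : Nice U) (hV : Nice V) (hU1 : ∫ x, U x = 1)
    (hV1 : ∫ x, V x = 1) {F G : ℝ → Eucl n → ℝ} (hF : ∀ t, 0 ≤ t → Nice (F t))
    (hG : ∀ t, 0 ≤ t → Nice (G t))
    (hUt : ∀ t, 0 ≤ t → gaussConv t U = fun x => F t x * gaussConv 1 (G t) x)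
    (hVt : ∀ t, 0 ≤ t → gaussConv t V = fun x => G t x * gaussConv 1 (F t) x)
    {τ : ℝ} (hτ : 0 ≤ τ) :
    potentialCost (F τ) (G τ) (gaussConv τ U) (gaussConv τ V) -
        (entDens n (gaussConv τ U) + entDens n (gaussConv τ V)) / 2 ≤
      potentialCost (F 0) (G 0) U V - (entDens n U + entDens n V) / 2 -
        n * ∫ t in (0 : ℝ)..τ,
          Real.sinh ((entDens n (gaussConv t U) - entDens n (gaussConv t V)) / (2 * n)) ^ 2 := by
  set h : ℝ → ℝ := fun t =>
    Real.sinh ((entDens n (gaussConv t U) - entDens n (gaussConv t V)) / (2 * n)) ^ 2 with hh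
  have hEU := hU.continuous_entDens
  have hEV := hV.continuous_entDens
  have hcont : Continuous h := by
    have := Real.continuous_sinh
    fun_prop
  have hmass : ∀ t, ∫ x, gaussConv t U x = 1 := fun t => by
    rw [integral_gaussConv hU.rapid, hU1]
  have hmass' : ∀ t, ∫ x, gaussConv t V x = 1 := fun t => by
    rw [integral_gaussConv hV.rapid, hV1]
  set R : ℝ → ℝ := fun t => -(entDens n (gaussConv t U) + entDens n (gaussConv t V)) / 2 +
    n * ∫ s in (0 : ℝ)..t, h s with hR
  have hRc : Continuous R := by
    have := intervalIntegral.continuous_primitive (μ := volume)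
      (fun a b => hcont.intervalIntegrable a b) 0
    fun_prop
  have key := le_of_left_dini_nonpos
    (B := fun t => potentialCost (F t) (G t) (gaussConv t U) (gaussConv t V) + R t) hτ ?_ ?_
  · simp only [hR, intervalIntegral.integral_same, gaussConv_zero] at key
    linarith
  · intro t ht ε hε
    have hFt := hF t ht.le
    have hGt := hG t ht.le
    have d1 := hasDerivAt_integral_mul_gaussConv hFt.log (hU.reg 2) ht
    have d2 := hasDerivAt_integral_mul_gaussConv hGt.log (hV.reg 2) ht
    have d3 := hU.hasDerivAt_entDens ht
    have d4 := hV.hasDerivAt_entDens ht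
    have d5 := intervalIntegral.integral_hasDerivAt_right (hcont.intervalIntegrable 0 t)
      hcont.aestronglyMeasurable.stronglyMeasurableAtFilter hcont.continuousAt
    have pU : ∀ x, F t x * gaussConv 1 (G t) x = gaussConv t U x := fun x => by rw [hUt t ht.le]
    have pV : ∀ x, G t x * gaussConv 1 (F t) x = gaussConv t V x := fun x => by rw [hVt t ht.le]
    have hD := hFt.dissipation_le hn hGt (by simp only [pU, hmass]) (by simp only [pV, hmass'])
    simp only [pU, pV] at hD
    simp only [pd_pd_gaussConv (hU.reg 2), pd_pd_gaussConv (hV.reg 2)] at hD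
    have d6 := (d1.add d2).add (((d3.add d4).neg.div_const 2).add (d5.const_mul (n : ℝ)))
    filter_upwards [d6.eventually_left_sub_le (by simp only [hh]; linarith) hε,
      Ioo_mem_nhdsLT ht] with s hs hs0
    have hle := (hF s hs0.1.le).potentialCost_le (hG s hs0.1.le) hFt.rapid hGt.rapid hFt.pos
      hGt.pos hFt.log hGt.log (by rw [← hUt s hs0.1.le, ← hUt t ht.le, hmass, hmass])
    rw [← hUt s hs0.1.le, ← hVt s hs0.1.le] at hle
    simp only [potentialCost, Pi.add_apply, Pi.neg_apply, hR] at hs hle ⊢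
    linarith
  · intro s hs ε hε
    filter_upwards [nhdsWithin_le_nhds (hRc.continuousAt.eventually (gt_mem_nhds
      (by linarith : R s < R s + ε))), self_mem_nhdsWithin] with t ht hst
    have hst : s < t := hst
    have ht0 : 0 ≤ t := hs.trans hst.le
    have hsemi : ∀ {W : Eucl n → ℝ}, Nice W → gaussConv (t - s) (gaussConv s W) = gaussConv t W :=
      fun hW => by rw [gaussConv_gaussConv hW.rapid (by linarith) hs, sub_add_cancel]
    have hle := (hF s hs).potentialCost_gaussConv_le (hG s hs) (hF t ht0) (hG t ht0) (h := t - s)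
      (by rw [← hUt s hs, ← hUt t ht0, hsemi hU]) (by rw [← hVt s hs, ← hVt t ht0, hsemi hV])
    rw [← hUt s hs, ← hVt s hs, ← hUt t ht0, ← hVt t ht0] at hle
    linarith

end Flow

section Cost

variable {n : ℕ} {f g φ w : Eucl n → ℝ}

instance : SigmaFinite (R01 n) := SigmaFinite.withDensity_ofReal _

lemma measurable_ofReal_of_continuous {X : Type*} [TopologicalSpace X] [MeasurableSpace X]
    [OpensMeasurableSpace X] {w : X → ℝ} (hw : Continuous w) :
    Measurable fun x => ENNReal.ofReal (w x) :=
  hw.measurable.ennreal_ofReal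

lemma Nice.entLeb_densMeas (hw : Nice w) : entLeb n (densMeas n w) = entDens n w := by
  have h := Measure.rnDeriv_withDensity (volume : Measure (Eucl n))
    (measurable_ofReal_of_continuous hw.rapid.1)
  refine integral_congr_ae ?_
  filter_upwards [h] with x hx
  rw [densMeas, hx, ENNReal.toReal_ofReal (hw.pos x).le]

lemma Nice.integral_densMeas (hw : Nice w) (φ : Eucl n → ℝ) :
    ∫ x, φ x ∂(densMeas n w) = ∫ x, φ x * w x := by
  rw [densMeas, integral_withDensity_eq_integral_toReal_smul
    (measurable_ofReal_of_continuous hw.rapid.1)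
    (Eventually.of_forall fun x => ENNReal.ofReal_lt_top)]
  congr 1
  funext x
  rw [ENNReal.toReal_ofReal (hw.pos x).le, smul_eq_mul, mul_comm]

lemma Nice.integrable_densMeas (hw : Nice w) (hφ : PolyGrowth φ) :
    Integrable φ (densMeas n w) := by
  rw [densMeas, integrable_withDensity_iff_integrable_smul'
    (measurable_ofReal_of_continuous hw.rapid.1)
    (Eventually.of_forall fun x => ENNReal.ofReal_lt_top)]
  refine (hφ.mul_rapid hw.rapid).integrable.congr (Eventually.of_forall fun x => ?_)
  simp only [ENNReal.toReal_ofReal (hw.pos x).le, smul_eq_mul, mul_comm]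

lemma Nice.isProbabilityMeasure_densMeas (hw : Nice w) (h : ∫ x, w x = 1) :
    IsProbabilityMeasure (densMeas n w) := by
  refine ⟨?_⟩
  rw [densMeas, withDensity_apply _ MeasurableSet.univ, Measure.restrict_univ,
    ← ofReal_integral_eq_lintegral_ofReal hw.integrable
      (Eventually.of_forall fun x => (hw.pos x).le),
    h, ENNReal.ofReal_one]

/-- The coupling `f(x) g(y) R₀₁(dx dy)`. -/
noncomputable def schrodingerPlan (f g : Eucl n → ℝ) : Measure (Eucl n × Eucl n) :=
  (R01 n).withDensity fun p => ENNReal.ofReal (f p.1 * g p.2)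

lemma Nice.continuous_prodMul (hf : Nice f) (hg : Nice g) :
    Continuous fun p : Eucl n × Eucl n => f p.1 * g p.2 := by
  have := hf.rapid.1
  have := hg.rapid.1
  fun_prop

lemma Nice.schrodingerPlan_eq (hf : Nice f) (hg : Nice g) :
    schrodingerPlan f g = ((volume : Measure (Eucl n)).prod volume).withDensity fun p =>
      ENNReal.ofReal (f p.1 * (g p.2 * gaussDens n (p.2 - p.1))) := by
  rw [schrodingerPlan, R01, ← withDensity_mul _ (measurable_ofReal_of_continuous (by fun_prop))
    (measurable_ofReal_of_continuous (hf.continuous_prodMul hg)), Measure.volume_eq_prod]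
  congr 1
  funext p
  simp only [Pi.mul_apply]
  rw [← ENNReal.ofReal_mul (by positivity), gaussDens, norm_sub_rev]
  ring_nf

lemma Nice.lintegral_mul_gaussDens_sub (hw : Nice w) {a : ℝ} (ha : 0 ≤ a) (x : Eucl n) :
    ∫⁻ y, ENNReal.ofReal (a * (w y * gaussDens n (y - x))) =
      ENNReal.ofReal (a * gaussConv 1 w x) := by
  rw [gaussConv_one, ← integral_const_mul, ofReal_integral_eq_lintegral_ofReal
    ((integrable_mul_comp_sub rapidDecay_gaussDens hw.rapid.polyGrowth x).const_mul a)
    (Eventually.of_forall fun y => mul_nonneg ha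
      (mul_nonneg (hw.pos y).le (gaussDens_pos (y - x)).le))]

lemma Nice.map_fst_schrodingerPlan (hf : Nice f) (hg : Nice g) :
    (schrodingerPlan f g).map Prod.fst = densMeas n fun x => f x * gaussConv 1 g x := by
  have hm : Measurable fun p : Eucl n × Eucl n =>
      ENNReal.ofReal (f p.1 * (g p.2 * gaussDens n (p.2 - p.1))) := by
    have h1 := hf.rapid.1
    have h2 := hg.rapid.1
    have h3 := (rapidDecay_gaussDens (n := n)).1
    exact measurable_ofReal_of_continuous (by fun_prop)
  ext A hA
  rw [Measure.map_apply measurable_fst hA, hf.schrodingerPlan_eq hg,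
    withDensity_apply _ (measurable_fst hA), densMeas, withDensity_apply _ hA, ← prod_univ,
    ← Measure.prod_restrict, lintegral_prod _ hm.aemeasurable, Measure.restrict_univ]
  simp only [hg.lintegral_mul_gaussDens_sub (hf.pos _).le]

lemma Nice.map_snd_schrodingerPlan (hf : Nice f) (hg : Nice g) :
    (schrodingerPlan f g).map Prod.snd = densMeas n fun x => g x * gaussConv 1 f x := by
  have hm : Measurable fun p : Eucl n × Eucl n =>
      ENNReal.ofReal (f p.1 * (g p.2 * gaussDens n (p.2 - p.1))) := by
    have h1 := hf.rapid.1
    have h2 := hg.rapid.1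
    have h3 := (rapidDecay_gaussDens (n := n)).1
    exact measurable_ofReal_of_continuous (by fun_prop)
  ext A hA
  rw [Measure.map_apply measurable_snd hA, hf.schrodingerPlan_eq hg,
    withDensity_apply _ (measurable_snd hA), densMeas, withDensity_apply _ hA, ← univ_prod,
    ← Measure.prod_restrict, lintegral_prod_symm _ hm.aemeasurable, Measure.restrict_univ]
  congr 1
  funext y
  rw [← hf.lintegral_mul_gaussDens_sub (hg.pos _).le]
  congr 1
  funext x
  rw [← gaussDens_neg (x - y), neg_sub]
  ring_nf

lemma Nice.coupling_schrodingerPlan (hf : Nice f) (hg : Nice g)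
    (hu : ∫ x, f x * gaussConv 1 g x = 1) :
    Coupling (schrodingerPlan f g) (densMeas n fun x => f x * gaussConv 1 g x)
      (densMeas n fun x => g x * gaussConv 1 f x) := by
  refine ⟨⟨?_⟩, hf.map_fst_schrodingerPlan hg, hf.map_snd_schrodingerPlan hg⟩
  have := ((hf.mul (hg.conv 1)).isProbabilityMeasure_densMeas hu).measure_univ
  rwa [← hf.map_fst_schrodingerPlan hg, Measure.map_apply measurable_fst MeasurableSet.univ,
    preimage_univ] at this

lemma Coupling.integral_log_add (hf : Nice f) (hg : Nice g) {π : Measure (Eucl n × Eucl n)}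
    (hπ : Coupling π (densMeas n fun x => f x * gaussConv 1 g x)
      (densMeas n fun x => g x * gaussConv 1 f x)) :
    Integrable (fun p => Real.log (f p.1 * g p.2)) π ∧
    ∫ p, Real.log (f p.1 * g p.2) ∂π = potentialCost f g (fun x => f x * gaussConv 1 g x)
      (fun x => g x * gaussConv 1 f x) := by
  have hU := hf.mul (hg.conv 1)
  have hV := hg.mul (hf.conv 1)
  obtain ⟨-, h1, h2⟩ := hπ
  have i1 := hU.integrable_densMeas hf.log
  have i2 := hV.integrable_densMeas hg.log
  have e1 := hU.integral_densMeas fun x => Real.log (f x)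
  have e2 := hV.integral_densMeas fun x => Real.log (g x)
  rw [← h1] at i1 e1
  rw [← h2] at i2 e2
  rw [integral_map measurable_fst.aemeasurable i1.1] at e1
  rw [integral_map measurable_snd.aemeasurable i2.1] at e2
  have j1 := i1.comp_aemeasurable measurable_fst.aemeasurable
  have j2 := i2.comp_aemeasurable measurable_snd.aemeasurable
  simp only [Function.comp_def] at j1 j2
  simp only [Real.log_mul (hf.pos _).ne' (hg.pos _).ne']
  exact ⟨j1.fun_add j2, by rw [integral_add j1 j2, e1, e2, potentialCost]⟩

lemma Nice.log_rnDeriv_schrodingerPlan (hf : Nice f) (hg : Nice g) :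
    (fun p => Real.log ((schrodingerPlan f g).rnDeriv (R01 n) p).toReal) =ᵐ[schrodingerPlan f g]
      fun p => Real.log (f p.1 * g p.2) := by
  have h := Measure.rnDeriv_withDensity (R01 n)
    (measurable_ofReal_of_continuous (hf.continuous_prodMul hg))
  filter_upwards [(withDensity_absolutelyContinuous (R01 n) _).ae_eq h] with p hp
  rw [schrodingerPlan, hp, ENNReal.toReal_ofReal (mul_pos (hf.pos _) (hg.pos _)).le]

lemma Nice.relEnt_schrodingerPlan (hf : Nice f) (hg : Nice g)
    (hu : ∫ x, f x * gaussConv 1 g x = 1) :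
    relEnt (schrodingerPlan f g) (R01 n) = ((potentialCost f g (fun x => f x * gaussConv 1 g x)
      (fun x => g x * gaussConv 1 f x) : ℝ) : EReal) := by
  have hlog := hf.log_rnDeriv_schrodingerPlan hg
  obtain ⟨i, e⟩ := (hf.coupling_schrodingerPlan hg hu).integral_log_add hf hg
  rw [relEnt, if_pos ⟨withDensity_absolutelyContinuous _ _, i.congr hlog.symm⟩,
    integral_congr_ae hlog, e]

lemma Nice.le_relEnt (hf : Nice f) (hg : Nice g) (hu : ∫ x, f x * gaussConv 1 g x = 1)
    {π : Measure (Eucl n × Eucl n)}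
    (hπ : Coupling π (densMeas n fun x => f x * gaussConv 1 g x)
      (densMeas n fun x => g x * gaussConv 1 f x)) :
    ((potentialCost f g (fun x => f x * gaussConv 1 g x) (fun x => g x * gaussConv 1 f x) : ℝ) :
      EReal) ≤ relEnt π (R01 n) := by
  rw [relEnt]
  split_ifs with h
  swap
  · exact le_top
  obtain ⟨hac, hint⟩ := h
  obtain ⟨i, e⟩ := hπ.integral_log_add hf hg
  have := hπ.1
  have := (hf.coupling_schrodingerPlan hg hu).1
  have hm := (measurable_ofReal_of_continuous (hf.continuous_prodMul hg)).aemeasurable (μ := R01 n)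
  have hne : ∀ p : Eucl n × Eucl n, ENNReal.ofReal (f p.1 * g p.2) ≠ 0 := fun p => by
    simpa using mul_pos (hf.pos p.1) (hg.pos p.2)
  have hac' : π ≪ schrodingerPlan f g :=
    hac.trans (withDensity_absolutelyContinuous' hm (Eventually.of_forall hne))
  have hkl := InformationTheory.toReal_klDiv_of_measure_eq hac' (by simp)
  have hllr : llr π (schrodingerPlan f g) =ᵐ[π] fun p =>
      Real.log (π.rnDeriv (R01 n) p).toReal - Real.log (f p.1 * g p.2) := by
    filter_upwards [hac.ae_eq (Measure.rnDeriv_withDensity_right π (R01 n) hm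
      (Eventually.of_forall hne) (Eventually.of_forall fun p => ENNReal.ofReal_ne_top)),
      Measure.rnDeriv_pos hac, hac.ae_le (Measure.rnDeriv_lt_top π (R01 n))] with p h1 h2 h3
    have hpos : 0 < f p.1 * g p.2 := mul_pos (hf.pos _) (hg.pos _)
    rw [llr, schrodingerPlan, h1, ENNReal.toReal_mul, ENNReal.toReal_inv,
      ENNReal.toReal_ofReal hpos.le, Real.log_mul (inv_ne_zero hpos.ne')
      (ENNReal.toReal_pos h2.ne' h3.ne).ne', Real.log_inv]
    ring
  rw [integral_congr_ae hllr, integral_sub hint i, e] at hkl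
  have := ENNReal.toReal_nonneg (a := InformationTheory.klDiv π (schrodingerPlan f g))
  exact EReal.coe_le_coe_iff.2 (by linarith)

/-- The entropic cost of a pair with a Schrödinger decomposition. -/
theorem Nice.entCost_eq (hf : Nice f) (hg : Nice g) (hu : ∫ x, f x * gaussConv 1 g x = 1) :
    entCost n (densMeas n fun x => f x * gaussConv 1 g x)
        (densMeas n fun x => g x * gaussConv 1 f x) =
      potentialCost f g (fun x => f x * gaussConv 1 g x) (fun x => g x * gaussConv 1 f x) -
        (entDens n (fun x => f x * gaussConv 1 g x) +
          entDens n fun x => g x * gaussConv 1 f x) / 2 := by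
  have hinf : (⨅ π : {π : Measure (Eucl n × Eucl n) // Coupling π
      (densMeas n fun x => f x * gaussConv 1 g x) (densMeas n fun x => g x * gaussConv 1 f x)},
      relEnt π.1 (R01 n)) = ((potentialCost f g (fun x => f x * gaussConv 1 g x)
        (fun x => g x * gaussConv 1 f x) : ℝ) : EReal) :=
    le_antisymm (iInf_le_of_le ⟨_, hf.coupling_schrodingerPlan hg hu⟩
      (hf.relEnt_schrodingerPlan hg hu).le) (le_iInf fun π => hf.le_relEnt hg hu π.2)
  rw [entCost, entCostE, hinf, (hf.mul (hg.conv 1)).entLeb_densMeas,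
    (hg.mul (hf.conv 1)).entLeb_densMeas, ← EReal.coe_sub, EReal.toReal_coe]

end Cost

section Main

variable {n : ℕ} {u w U W : Eucl n → ℝ} {μ ν : Measure (Eucl n)}

lemma IsSchwartz.nice (hw : IsSchwartz n w)
    (hl : ∃ α c : ℝ, 0 < α ∧ 0 < c ∧ ∀ x, c * Real.exp (-α * ‖x‖ ^ 2) ≤ w x) : Nice w := by
  obtain ⟨f, rfl⟩ := hw
  exact ⟨f.reg, hl⟩

lemma PiS.exists_nice (h : PiS n μ ν) : ∃ f g : Eucl n → ℝ, Nice f ∧ Nice g ∧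
    μ = densMeas n (fun x => f x * gaussConv 1 g x) ∧
    ν = densMeas n (fun x => g x * gaussConv 1 f x) := by
  obtain ⟨f, g, hf, hg, -, -, ⟨α, c, hα, hc, hlf, hlg⟩, hμ, hν⟩ := h
  simp only [heat_eq_gaussConv zero_le_one] at hμ hν
  exact ⟨f, g, hf.nice ⟨α, c, hα, hc, hlf⟩, hg.nice ⟨α, c, hα, hc, hlg⟩, hμ, hν⟩

lemma densMeas_congr (h : u =ᵐ[volume] w) : densMeas n u = densMeas n w :=
  withDensity_congr_ae (h.fun_comp ENNReal.ofReal)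

lemma entDens_congr (h : u =ᵐ[volume] w) : entDens n u = entDens n w :=
  integral_congr_ae (h.fun_comp fun r => r * Real.log r)

lemma Nice.ae_eq_of_densMeas_eq (hU : Nice U) (hu : AEMeasurable u)
    (h : densMeas n u = densMeas n U) : u =ᵐ[volume] U := by
  filter_upwards [(withDensity_eq_iff_of_sigmaFinite hu.ennreal_ofReal
    hU.rapid.1.measurable.ennreal_ofReal.aemeasurable).1 h] with x hx
  have hpos : 0 < u x := by
    rw [← ENNReal.ofReal_pos, hx, ENNReal.ofReal_pos]
    exact hU.pos x
  exact (ENNReal.ofReal_eq_ofReal_iff hpos.le (hU.pos x).le).1 hx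

lemma Nice.eq_of_densMeas_eq (hU : Nice U) (hW : Nice W) (h : densMeas n U = densMeas n W) :
    U = W :=
  (hU.rapid.1.ae_eq_iff_eq volume hW.rapid.1).1
    (hW.ae_eq_of_densMeas_eq hU.rapid.1.aemeasurable h)

lemma Nice.integral_eq_one (hU : Nice U) (h : IsProbabilityMeasure (densMeas n U)) :
    ∫ x, U x = 1 := by
  have h1 := h.measure_univ
  rw [densMeas, withDensity_apply _ MeasurableSet.univ, Measure.restrict_univ,
    ← ofReal_integral_eq_lintegral_ofReal hU.integrable
      (Eventually.of_forall fun x => (hU.pos x).le)] at h1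
  simpa using h1

/-- A function without measurability has a vanishing Bochner integral, hence a vanishing heat
evolution. -/
lemma aemeasurable_of_densMeas_heat_eq (hW : Nice W) {t : ℝ} (ht : 0 < t)
    (h : densMeas n (heat n t u) = densMeas n W) : AEMeasurable u := by
  obtain ⟨x, hx⟩ : ∃ x, heat n t u x ≠ 0 := by
    by_contra! hzero
    have h0 : densMeas n W = 0 := by
      rw [← h, densMeas]
      simp [hzero]
    have h1 := (withDensity_eq_zero_iff
      hW.rapid.1.measurable.ennreal_ofReal.aemeasurable).1 h0
    obtain ⟨y, hy⟩ := h1.exists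
    have := hW.pos y
    rw [Pi.zero_apply, ENNReal.ofReal_eq_zero] at hy
    linarith
  rw [heat, if_neg ht.ne'] at hx
  have hi := (not_imp_comm.1 integral_undef hx).1.aemeasurable
  have hk : Measurable fun y : Eucl n =>
      (Real.exp (-‖x - y‖ ^ 2 / (2 * t)) / (2 * Real.pi * t) ^ ((n : ℝ) / 2))⁻¹ := by
    fun_prop
  refine (hi.mul hk.aemeasurable).congr (Eventually.of_forall fun y => ?_)
  have : 0 < (2 * Real.pi * t) ^ ((n : ℝ) / 2) := by positivity
  simp only [Pi.mul_apply]
  field_simp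

lemma heat_ae_eq (h : u =ᵐ[volume] U) {t : ℝ} (ht : 0 ≤ t) :
    heat n t u =ᵐ[volume] gaussConv t U := by
  rw [← heat_eq_gaussConv ht]
  rcases ht.eq_or_lt with rfl | ht
  · filter_upwards [h] with x hx
    simpa [heat] using hx
  · refine Eventually.of_forall fun x => ?_
    simp only [heat, if_neg ht.ne']
    refine integral_congr_ae ?_
    filter_upwards [h] with y hy
    rw [hy]

end Main

/-- Dimensional contraction of the entropic cost along the heat flow. -/
theorem entropic_cost_contraction (n : ℕ) (hn : 1 ≤ n) (u v : Eucl n → ℝ)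
    (hu : IsProbabilityMeasure (densMeas n u)) (hv : IsProbabilityMeasure (densMeas n v))
    (hPiS : ∀ s t : ℝ, 0 ≤ s → 0 ≤ t →
      PiS n (densMeas n (heat n s u)) (densMeas n (heat n t v))) :
    ∀ τ : ℝ, 0 < τ →
      entCost n (densMeas n (heat n τ u)) (densMeas n (heat n τ v))
        ≤ entCost n (densMeas n u) (densMeas n v)
          - n * ∫ t in (0 : ℝ)..τ,
              Real.sinh ((entDens n (heat n t u) - entDens n (heat n t v)) / (2 * n)) ^ 2 := by

  intro τ hτ
  choose! F G hF hG hμ hν using fun t (ht : 0 ≤ t) => (hPiS t t ht ht).exists_nice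
  have hFG := (hF 1 zero_le_one).mul ((hG 1 zero_le_one).conv 1)
  have hGF := (hG 1 zero_le_one).mul ((hF 1 zero_le_one).conv 1)
  have hheat0 : ∀ w : Eucl n → ℝ, heat n 0 w = w := fun w => by
    funext x
    simp [heat]
  obtain ⟨U, hU, huU⟩ : ∃ U, Nice U ∧ u =ᵐ[volume] U := by
    have hN := (hF 0 le_rfl).mul ((hG 0 le_rfl).conv 1)
    refine ⟨_, hN, hN.ae_eq_of_densMeas_eq
      (aemeasurable_of_densMeas_heat_eq hFG one_pos (hμ 1 zero_le_one)) ?_⟩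
    rw [← hμ 0 le_rfl, hheat0]
  obtain ⟨V, hV, hvV⟩ : ∃ V, Nice V ∧ v =ᵐ[volume] V := by
    have hN := (hG 0 le_rfl).mul ((hF 0 le_rfl).conv 1)
    refine ⟨_, hN, hN.ae_eq_of_densMeas_eq
      (aemeasurable_of_densMeas_heat_eq hGF one_pos (hν 1 zero_le_one)) ?_⟩
    rw [← hν 0 le_rfl, hheat0]
  have hU1 : ∫ x, U x = 1 := hU.integral_eq_one (densMeas_congr huU ▸ hu)
  have hV1 : ∫ x, V x = 1 := hV.integral_eq_one (densMeas_congr hvV ▸ hv)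
  have hUt : ∀ t, 0 ≤ t → gaussConv t U = fun x => F t x * gaussConv 1 (G t) x := fun t ht =>
    (hU.conv t).eq_of_densMeas_eq ((hF t ht).mul ((hG t ht).conv 1))
      ((densMeas_congr (heat_ae_eq huU ht)).symm.trans (hμ t ht))
  have hVt : ∀ t, 0 ≤ t → gaussConv t V = fun x => G t x * gaussConv 1 (F t) x := fun t ht =>
    (hV.conv t).eq_of_densMeas_eq ((hG t ht).mul ((hF t ht).conv 1))
      ((densMeas_congr (heat_ae_eq hvV ht)).symm.trans (hν t ht))
  have hcost : ∀ t, 0 ≤ t → entCost n (densMeas n (heat n t u)) (densMeas n (heat n t v)) =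
      potentialCost (F t) (G t) (gaussConv t U) (gaussConv t V) -
        (entDens n (gaussConv t U) + entDens n (gaussConv t V)) / 2 := fun t ht => by
    have hmass : ∫ x, F t x * gaussConv 1 (G t) x = 1 := by
      simpa only [hUt t ht, hU1] using integral_gaussConv hU.rapid t
    rw [densMeas_congr (heat_ae_eq huU ht), densMeas_congr (heat_ae_eq hvV ht), hUt t ht,
      hVt t ht, (hF t ht).entCost_eq (hG t ht) hmass]
  have hint : ∫ t in (0 : ℝ)..τ,
        Real.sinh ((entDens n (heat n t u) - entDens n (heat n t v)) / (2 * n)) ^ 2 =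
      ∫ t in (0 : ℝ)..τ,
        Real.sinh ((entDens n (gaussConv t U) - entDens n (gaussConv t V)) / (2 * n)) ^ 2 := by
    refine intervalIntegral.integral_congr fun t ht => ?_
    rw [uIcc_of_le hτ.le] at ht
    simp only [entDens_congr (heat_ae_eq huU ht.1), entDens_congr (heat_ae_eq hvV ht.1)]
  have h0 := hcost 0 le_rfl
  rw [hheat0, hheat0, gaussConv_zero, gaussConv_zero] at h0
  rw [hcost τ hτ.le, h0, hint]
  exact potentialCost_flow_le hn hU hV hU1 hV1 hF hG hUt hVt hτ.le
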